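/- arXiv:2009.09517 — 2 statements merged into one kernel-verified Lean document; each statement's English description precedes it below -/
import Mathlib

section
/- Let n ≥ 6 and let l be a real number with n−4 < l < n−2 and l ∉ ℕ. Consider the discrete thread consisting of n rigid unit segments joined consecutively by hinges, with the two endpoints of the chain fixed at distance l apart; its configuration space can be realized as the subspace M = {u ∈ (S¹)^n : Σ_{i=1}^{n} u_i = l} of the n-torus, where S¹ is the unit circle in ℂ and l is regarded as the complex number l + 0i. Then for every basepoint x ∈ M, the fundamental group π_1(M, x) is isomorphic to the free group on n generators. -/
section FreeFundamentalGroup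

open Set Topology unitInterval

variable {X : Type*} [TopologicalSpace X]

theorem Path.Homotopic.Quotient.induction_of_isOpen_cover {κ : Type*} {c : κ → Set X}
    (hc : ∀ k, IsOpen (c k)) (hcov : ∀ x, ∃ k, x ∈ c k)
    {Q : ∀ {x y : X}, Path.Homotopic.Quotient x y → Prop}
    (hQ : ∀ {k x y} (γ : Path x y), range γ ⊆ c k → Q (.mk γ))
    (htrans : ∀ {x y z : X} (p : Path.Homotopic.Quotient x y) (q : Path.Homotopic.Quotient y z),
      Q p → Q q → Q (p.trans q))
    {x y : X} (p : Path.Homotopic.Quotient x y) : Q p := by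
  obtain ⟨γ, rfl⟩ := mk_surjective p
  obtain ⟨t, ht0, hmono, ⟨N, hN⟩, hsub⟩ :=
    exists_monotone_Icc_subset_open_cover_unitInterval (c := fun k => γ ⁻¹' c k)
      (fun k => (hc k).preimage γ.continuous)
      (fun s _ => mem_iUnion.2 (hcov (γ s)))
  have key : ∀ m, Q (mk (γ.subpath (t 0) (t m))) := by
    intro m
    induction m with
    | zero =>
      obtain ⟨k, hk⟩ := hcov (γ (t 0))
      refine hQ (k := k) _ ?_
      rw [Path.range_subpath_of_le _ _ _ le_rfl, Icc_self, image_singleton, singleton_subset_iff]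
      exact hk
    | succ m ih =>
      obtain ⟨k, hk⟩ := hsub m
      have h1 : Q (mk (γ.subpath (t m) (t (m + 1)))) := by
        refine hQ (k := k) _ ?_
        rw [Path.range_subpath_of_le _ _ _ (hmono m.le_succ)]
        exact image_subset_iff.2 hk
      have h2 := htrans _ _ ih h1
      rwa [← mk_trans, Quotient.eq.2 ⟨Path.Homotopy.subpathTransSubpath γ (t 0) (t m) (t (m + 1))⟩]
        at h2
  have h := key N
  rw [ht0, hN N le_rfl, Path.subpath_zero_one] at h
  have aux : ∀ {x' y'} (hx : x' = x) (hy : y' = y), Q (mk (γ.cast hx hy)) → Q (mk γ) := by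
    rintro _ _ rfl rfl h
    exact h
  exact aux _ _ h

theorem IsSimplyConnected.homotopic_of_range_subset {S : Set X} (hS : IsSimplyConnected S) {x y : X}
    (γ γ' : Path x y) (h : range γ ⊆ S) (h' : range γ' ⊆ S) : γ.Homotopic γ' := by
  have := hS.simplyConnectedSpace
  have hx : x ∈ S := h ⟨0, γ.source⟩
  have hy : y ∈ S := h ⟨1, γ.target⟩
  let δ : Path (⟨x, hx⟩ : S) ⟨y, hy⟩ :=
    { toFun := fun t => ⟨γ t, h ⟨t, rfl⟩⟩
      continuous_toFun := by fun_prop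
      source' := Subtype.ext γ.source
      target' := Subtype.ext γ.target }
  let δ' : Path (⟨x, hx⟩ : S) ⟨y, hy⟩ :=
    { toFun := fun t => ⟨γ' t, h' ⟨t, rfl⟩⟩
      continuous_toFun := by fun_prop
      source' := Subtype.ext γ'.source
      target' := Subtype.ext γ'.target }
  exact (SimplyConnectedSpace.paths_homotopic δ δ').map ⟨Subtype.val, continuous_subtype_val⟩

/-- The class of paths joining two points inside a simply connected set, as a morphism of the
fundamental groupoid. -/
noncomputable def IsSimplyConnected.hom {S : Set X} (hS : IsSimplyConnected S) {x y : X}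
    (hx : x ∈ S) (hy : y ∈ S) : FundamentalGroupoid.mk x ⟶ FundamentalGroupoid.mk y :=
  Path.Homotopic.Quotient.mk (hS.isPathConnected.joinedIn x hx y hy).somePath

open CategoryTheory

namespace IsSimplyConnected

variable {S : Set X} (hS : IsSimplyConnected S) {x y z : X}

theorem mk_eq_hom (γ : Path x y) (h : range γ ⊆ S) (hx : x ∈ S) (hy : y ∈ S) :
    Path.Homotopic.Quotient.mk γ = hS.hom hx hy :=
  Path.Homotopic.Quotient.eq.2 <| hS.homotopic_of_range_subset _ _ h <| by
    rintro _ ⟨t, rfl⟩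
    exact JoinedIn.somePath_mem _ t

theorem hom_comp (hx : x ∈ S) (hy : y ∈ S) (hz : z ∈ S) :
    hS.hom hx hy ≫ hS.hom hy hz = hS.hom hx hz := by
  refine Eq.trans ?_ (hS.mk_eq_hom ((hS.isPathConnected.joinedIn x hx y hy).somePath.trans
    (hS.isPathConnected.joinedIn y hy z hz).somePath) ?_ hx hz)
  · rfl
  · rw [Path.trans_range, union_subset_iff]
    constructor <;> rintro _ ⟨t, rfl⟩ <;> exact JoinedIn.somePath_mem _ t

theorem hom_self (hx : x ∈ S) : hS.hom hx hx = 𝟙 _ :=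
  (hS.mk_eq_hom (Path.refl x) (by simpa using hx) hx hx).symm

theorem hom_eq_hom {S' P : Set X} (hS' : IsSimplyConnected S') (hP : IsPathConnected P)
    (h : P ⊆ S) (h' : P ⊆ S') (hx : x ∈ P) (hy : y ∈ P) :
    hS.hom (h hx) (h hy) = hS'.hom (h' hx) (h' hy) := by
  have hr : range (hP.joinedIn x hx y hy).somePath ⊆ P := by
    rintro _ ⟨t, rfl⟩
    exact JoinedIn.somePath_mem _ t
  rw [← hS.mk_eq_hom _ (hr.trans h), ← hS'.mk_eq_hom _ (hr.trans h')]

end IsSimplyConnected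

open Bundle in
theorem exists_transport_of_locallyConstant {κ G : Type*} [Group G] {c : κ → Set X}
    (hc : ∀ k, IsOpen (c k)) (hcov : ∀ x, ∃ k, x ∈ c k) (T : κ → X → G)
    (hT : ∀ j k, ∀ x ∈ c j ∩ c k, ∀ᶠ y in 𝓝 x, (T k y)⁻¹ * T j y = (T k x)⁻¹ * T j x) :
    ∃ h : ∀ {x y : X}, Path.Homotopic.Quotient x y → G → G,
      (∀ {x} w, h (.refl x) w = w) ∧
      (∀ {x y z} (p : Path.Homotopic.Quotient x y) (q : Path.Homotopic.Quotient y z) w,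
        h (p.trans q) w = h q (h p w)) ∧
      ∀ {k x y} (γ : Path x y), range γ ⊆ c k → ∀ w, h (.mk γ) w = T k y * (T k x)⁻¹ * w := by
  let _ : TopologicalSpace G := ⊥
  have _ : DiscreteTopology G := ⟨rfl⟩
  choose idx hidx using hcov
  let Z : FiberBundleCore κ X G :=
    { baseSet := c
      isOpen_baseSet := hc
      indexAt := idx
      mem_baseSet_at := hidx
      coordChange := fun j k x w => (T k x)⁻¹ * T j x * w
      coordChange_self := by simp
      continuousOn_coordChange := by
        rintro j k ⟨x, w⟩ ⟨hx, -⟩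
        refine ContinuousAt.continuousWithinAt ?_
        refine (continuousAt_const (y := (T k x)⁻¹ * T j x * w)).congr ?_
        have h1 : ∀ᶠ p : X × G in 𝓝 (x, w), (T k p.1)⁻¹ * T j p.1 = (T k x)⁻¹ * T j x :=
          (continuousAt_fst (p := (x, w))).eventually (hT j k x hx)
        have h2 : ∀ᶠ p : X × G in 𝓝 (x, w), p.2 = w :=
          (continuousAt_snd (p := (x, w))).eventually (p := fun v => v = w)
            (by simp [nhds_discrete])
        filter_upwards [h1, h2] with p hp1 hp2
        rw [hp1, hp2]
      coordChange_comp := by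
        intro i j k x _ v
        simp [mul_assoc] }
  have hfib : ∀ b, DiscreteTopology (Z.Fiber b) := fun b => ⟨rfl⟩
  have cov : IsCoveringMap (π G Z.Fiber) := FiberBundle.isCoveringMap
  let pt (x : X) (w : G) : (π G Z.Fiber) ⁻¹' {x} := ⟨⟨x, (T (idx x) x)⁻¹ * w⟩, rfl⟩
  let pr {x : X} (e : (π G Z.Fiber) ⁻¹' {x}) : G := T (idx x) x * (show G from e.1.2)
  have hpr : ∀ x w, pr (pt x w) = w := by
    intro x w
    simp only [pr, pt]
    exact mul_inv_cancel_left _ _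
  have hpt : ∀ x e, pt x (pr e) = e := by
    rintro x ⟨⟨x', e⟩, rfl⟩
    simp only [pr, pt]
    congr 2
    exact inv_mul_cancel_left (T (idx x') x') (show G from e)
  refine ⟨fun {x y} p w => pr (cov.monodromy p (pt x w)), ?_, ?_, ?_⟩
  · intro x w
    beta_reduce
    rw [cov.monodromy_refl]
    exact hpr x w
  · intro x y z p q w
    beta_reduce
    rw [cov.monodromy_trans_apply, hpt]
  · intro k x y γ hγ w
    have hx : x ∈ c k := hγ ⟨0, γ.source⟩
    have hy : y ∈ c k := hγ ⟨1, γ.target⟩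
    have : cov.monodromy (.mk γ) (pt x w) = pt y (T k y * (T k x)⁻¹ * w) := by
      let Γ : Path (pt x w).1 (pt y (T k y * (T k x)⁻¹ * w)).1 :=
        { toFun := fun t => (Z.localTriv k).toOpenPartialHomeomorph.symm (γ t, (T k x)⁻¹ * w)
          continuous_toFun := by
            refine (Z.localTriv k).toOpenPartialHomeomorph.continuousOn_symm.comp_continuous
              (by fun_prop) ?_
            intro t
            refine (Z.mem_localTriv_target k _).2 ?_
            exact hγ ⟨t, rfl⟩
          source' := by
            rw [γ.source, Z.localTriv_symm_apply]
            simp only [pt, Z]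
            congr 1
            simp only [mul_assoc, mul_inv_cancel_left]
            rfl
          target' := by
            rw [γ.target, Z.localTriv_symm_apply]
            simp only [pt, Z]
            congr 1
            simp only [mul_assoc]
            rfl }
      refine cov.monodromy_eq_of_map_eq (.mk Γ) ?_
      exact congrArg Path.Homotopic.Quotient.mk (Path.ext rfl)
    beta_reduce
    rw [this, hpr]

/-- The van Kampen theorem for a simply connected open set `U` with simply connected open handles
`V i` attached along two path connected pieces `P i` and `N i` each. -/
theorem nonempty_fundamentalGroup_mulEquiv_freeGroup {ι : Type*} {U : Set X} {V P N : ι → Set X}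
    (hUo : IsOpen U) (hVo : ∀ i, IsOpen (V i)) (hPo : ∀ i, IsOpen (P i)) (hNo : ∀ i, IsOpen (N i))
    (hcov : ∀ x, x ∈ U ∨ ∃ i, x ∈ V i) (hVd : ∀ i j, i ≠ j → Disjoint (V i) (V j))
    (hVU : ∀ i, V i ∩ U = P i ∪ N i) (hPN : ∀ i, Disjoint (P i) (N i))
    (hU : IsSimplyConnected U) (hV : ∀ i, IsSimplyConnected (V i))
    (hP : ∀ i, IsPathConnected (P i)) (hN : ∀ i, IsPathConnected (N i)) (x : X) :
    Nonempty (FundamentalGroup X x ≃* FreeGroup ι) := by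
  classical
  obtain ⟨x₀, hx₀⟩ := hU.nonempty
  have hPV : ∀ i, P i ⊆ V i := fun i y hy => ((hVU i).ge (Or.inl hy)).1
  have hPU : ∀ i, P i ⊆ U := fun i y hy => ((hVU i).ge (Or.inl hy)).2
  have hNV : ∀ i, N i ⊆ V i := fun i y hy => ((hVU i).ge (Or.inr hy)).1
  have hNU : ∀ i, N i ⊆ U := fun i y hy => ((hVU i).ge (Or.inr hy)).2
  choose a ha using fun i => (hP i).nonempty
  choose b hb using fun i => (hN i).nonempty
  let g (i : ι) : FundamentalGroup X x₀ :=
    hU.hom hx₀ (hPU i (ha i)) ≫ (hV i).hom (hPV i (ha i)) (hNV i (hb i)) ≫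
      hU.hom (hNU i (hb i)) hx₀
  let f : FreeGroup ι →* FundamentalGroup X x₀ := FreeGroup.lift g
  let c : Option ι → Set X := fun o => o.elim U V
  have hco : ∀ o, IsOpen (c o) := by
    rintro (_ | i)
    exacts [hUo, hVo i]
  have hcc : ∀ y, ∃ o, y ∈ c o := fun y =>
    (hcov y).elim (fun h => ⟨none, h⟩) fun ⟨i, h⟩ => ⟨some i, h⟩
  let D : ∀ (o : Option ι) {y : X}, y ∈ c o → (FundamentalGroupoid.mk y ⟶ .mk x₀) := fun o =>
    match o with
    | none => fun h => hU.hom h hx₀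
    | some i => fun h => (hV i).hom h (hPV i (ha i)) ≫ hU.hom (hPU i (ha i)) hx₀
  have hD : ∀ {o y z} (γ : Path y z) (h : range γ ⊆ c o) (hy : y ∈ c o) (hz : z ∈ c o),
      (show FundamentalGroupoid.mk y ⟶ .mk z from .mk γ) ≫ D o hz = D o hy := by
    rintro (_ | i) y z γ h hy hz
    · rw [hU.mk_eq_hom γ h hy hz]
      exact hU.hom_comp _ _ _
    · rw [(hV i).mk_eq_hom γ h hy hz]
      exact (Category.assoc _ _ _).symm.trans (congrArg (· ≫ _) ((hV i).hom_comp hy hz _))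
  have hUV : ∀ {i y} (hy : y ∈ U) (hy' : y ∈ V i),
      ∃ w : FreeGroup ι, hU.hom hy hx₀ = D (some i) hy' ≫ f w := by
    intro i y hy hy'
    rcases (hVU i).le ⟨hy', hy⟩ with h | h
    · refine ⟨1, ?_⟩
      rw [map_one]
      simp only [D]
      rw [(hV i).hom_eq_hom hU (hP i) (hPV i) (hPU i) h (ha i), hU.hom_comp]
      exact (Category.comp_id _).symm
    · refine ⟨FreeGroup.of i, ?_⟩
      simp only [D, f, FreeGroup.lift_apply_of, g]
      rw [Category.assoc, ← Category.assoc (hU.hom _ _), hU.hom_comp, hU.hom_self, Category.id_comp,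
        ← Category.assoc, (hV i).hom_comp,
        (hV i).hom_eq_hom hU (hN i) (hNV i) (hNU i) h (hb i), hU.hom_comp]
  have hDD : ∀ {o o' y} (hy : y ∈ c o) (hy' : y ∈ c o'),
      ∃ w : FreeGroup ι, D o hy = D o' hy' ≫ f w := by
    have hinv : ∀ {y} {p q : FundamentalGroupoid.mk y ⟶ .mk x₀},
        (∃ w : FreeGroup ι, p = q ≫ f w) → ∃ w : FreeGroup ι, q = p ≫ f w := by
      rintro y p q ⟨w, rfl⟩
      refine ⟨w⁻¹, ?_⟩
      have h : f w ≫ f w⁻¹ = 𝟙 _ := by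
        change f w⁻¹ * f w = 1
        rw [← map_mul, inv_mul_cancel, map_one]
      rw [Category.assoc, h, Category.comp_id]
    rintro (_ | i) (_ | j) y hy hy'
    · exact ⟨1, by rw [map_one]; exact (Category.comp_id _).symm⟩
    · exact hUV hy hy'
    · exact hinv (hUV hy' hy)
    · obtain rfl : i = j := by
        by_contra hij
        exact disjoint_left.1 (hVd i j hij) hy hy'
      exact ⟨1, by rw [map_one]; exact (Category.comp_id _).symm⟩
  have hsurj : Function.Surjective f := by
    have key : ∀ {y z : X} (p : Path.Homotopic.Quotient y z),
        ∀ q : FundamentalGroupoid.mk x₀ ⟶ .mk y,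
          (∃ (o : _) (h : y ∈ c o) (w : FreeGroup ι), q ≫ D o h = f w) →
          ∃ (o : _) (h : z ∈ c o) (w : FreeGroup ι),
            (q ≫ (show FundamentalGroupoid.mk y ⟶ .mk z from p)) ≫ D o h = f w := by
      intro y z p
      refine Path.Homotopic.Quotient.induction_of_isOpen_cover hco hcc
        (Q := fun {y z} p => ∀ q : FundamentalGroupoid.mk x₀ ⟶ .mk y,
          (∃ (o : _) (h : y ∈ c o) (w : FreeGroup ι), q ≫ D o h = f w) →
          ∃ (o : _) (h : z ∈ c o) (w : FreeGroup ι),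
            (q ≫ (show FundamentalGroupoid.mk y ⟶ .mk z from p)) ≫ D o h = f w) ?_ ?_ p
      · rintro k y z γ hγ q ⟨o, hy, w, hw⟩
        have hyk : y ∈ c k := hγ ⟨0, γ.source⟩
        have hzk : z ∈ c k := hγ ⟨1, γ.target⟩
        obtain ⟨v, hv⟩ := hDD hyk hy
        refine ⟨k, hzk, v * w, ?_⟩
        rw [Category.assoc, hD γ hγ hyk hzk, hv, ← Category.assoc, hw, map_mul]
        rfl
      · intro y z t p p' hp hp' q hq
        have := hp' _ (hp q hq)
        rwa [Category.assoc] at this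
    intro p
    obtain ⟨o, h, w, hw⟩ := key p (𝟙 _) ⟨none, hx₀, 1, by
      rw [map_one]
      simp only [D]
      rw [hU.hom_self]
      exact Category.comp_id _⟩
    obtain ⟨v, hv⟩ := hDD (o := none) hx₀ h
    refine ⟨v * w, ?_⟩
    rw [map_mul, ← hw]
    change _ ≫ _ = _
    rw [Category.assoc, ← hv, Category.id_comp]
    simp only [D]
    rw [hU.hom_self]
    exact Category.comp_id _
  have hinj : Function.Injective f := by
    let T : Option ι → X → FreeGroup ι := fun o y =>
      o.elim 1 fun i => if y ∈ N i then FreeGroup.of i else 1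
    have hTloc : ∀ i, ∀ y ∈ V i ∩ U, ∀ᶠ z in 𝓝 y, T (some i) z = T (some i) y := by
      intro i y hy
      rcases (hVU i).le hy with h | h
      · filter_upwards [(hPo i).mem_nhds h] with z hz
        simp only [T, Option.elim, if_neg (disjoint_left.1 (hPN i) h),
          if_neg (disjoint_left.1 (hPN i) hz)]
      · filter_upwards [(hNo i).mem_nhds h] with z hz
        simp only [T, Option.elim, if_pos h, if_pos hz]
    obtain ⟨h, h1, h2, h3⟩ := exists_transport_of_locallyConstant hco hcc T <| by
      rintro (_ | i) (_ | j) y ⟨hy, hy'⟩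
      · exact .of_forall fun z => by simp [T]
      · filter_upwards [hTloc j y ⟨hy', hy⟩] with z hz
        rw [hz]
        rfl
      · filter_upwards [hTloc i y ⟨hy, hy'⟩] with z hz
        rw [hz]
        rfl
      · obtain rfl : i = j := by
          by_contra hij
          exact disjoint_left.1 (hVd i j hij) hy hy'
        exact .of_forall fun z => by simp
    have hhom : ∀ {o y z} (S : IsSimplyConnected (c o)) (hy : y ∈ c o) (hz : z ∈ c o) w,
        h (S.hom hy hz) w = T o z * (T o y)⁻¹ * w := by
      intro o y z S hy hz w
      refine h3 _ ?_ w
      rintro _ ⟨t, rfl⟩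
      exact JoinedIn.somePath_mem _ t
    have hg : ∀ i w, h (g i) w = FreeGroup.of i * w := by
      intro i w
      change h (Path.Homotopic.Quotient.trans _ (Path.Homotopic.Quotient.trans _ _)) w = _
      rw [h2, h2]
      refine (hhom (o := none) hU (hNU i (hb i)) hx₀ _).trans (Eq.trans (congrArg _
        ((hhom (o := some i) (hV i) (hPV i (ha i)) (hNV i (hb i)) _).trans
          (congrArg _ (hhom (o := none) hU hx₀ (hPU i (ha i)) w)))) ?_)
      simp [T, if_pos (hb i), if_neg (disjoint_left.1 (hPN i) (ha i))]
    have hf : ∀ v w, h (f v) w = v * w := by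
      intro v
      induction v using FreeGroup.induction_on with
      | C1 =>
        intro w
        rw [map_one, one_mul]
        exact h1 w
      | of i =>
        intro w
        simp only [f, FreeGroup.lift_apply_of]
        exact hg i w
      | inv_of i hi =>
        intro w
        have : h (f (FreeGroup.of i) * f (FreeGroup.of i)⁻¹) w = w := by
          rw [← map_mul, mul_inv_cancel, map_one]
          exact h1 w
        rw [FundamentalGroup.mul_def, h2, hi] at this
        rw [eq_inv_mul_iff_mul_eq]
        exact this
      | mul u v hu hv =>
        intro w
        rw [map_mul, FundamentalGroup.mul_def, h2, hv, hu, mul_assoc]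
    rw [injective_iff_map_eq_one]
    intro v hv
    have := hf v 1
    rw [hv, mul_one] at this
    rw [← this]
    exact h1 1
  have hjoin : ∀ y ∈ U, Joined x₀ y := fun y hy => (hU.isPathConnected.joinedIn _ hx₀ _ hy).joined
  have hx : Joined x₀ x := by
    rcases hcov x with h | ⟨i, h⟩
    · exact hjoin x h
    · exact (hjoin _ (hPU i (ha i))).trans
        ((hV i).isPathConnected.joinedIn _ (hPV i (ha i)) _ h).joined
  exact ⟨(FundamentalGroup.fundamentalGroupMulEquivOfPath hx.somePath.symm).trans
    (MulEquiv.ofBijective f ⟨hinj, hsurj⟩).symm⟩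

end FreeFundamentalGroup

section GeneralPosition

open Set Topology unitInterval

variable {E : Type*} [NormedAddCommGroup E] [NormedSpace ℝ E]

theorem segment_subset_diff_iUnion {ι : Type*} {C : Set E} (hC : Convex ℝ C)
    {L : ι → Submodule ℝ E} {p a : E} (hp : p ∈ C)
    (ha : a ∈ C \ ⋃ k, (L k : Set E)) (h : ∀ k, ∀ w ∈ L k, ∀ r : ℝ, p ≠ w + r • a) :
    segment ℝ p a ⊆ C \ ⋃ k, (L k : Set E) := by
  rintro _ ⟨s, t, hs, ht, hst, rfl⟩
  refine ⟨hC hp ha.1 hs ht hst, ?_⟩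
  rw [mem_iUnion, not_exists]
  intro k hk
  rcases eq_or_ne s 0 with rfl | hs0
  · obtain rfl : t = 1 := by linarith
    exact ha.2 (mem_iUnion.2 ⟨k, by simpa using hk⟩)
  · refine h k _ ((L k).smul_mem s⁻¹ hk) (-(s⁻¹ * t)) ?_
    rw [smul_add, smul_smul, smul_smul, inv_mul_cancel₀ hs0]
    module

variable [FiniteDimensional ℝ E]

/-- A nonempty open set contains a point avoiding finitely many cones over `C¹` curves
with subspaces of codimension at least three as vertices. -/
theorem exists_mem_forall_ne_add_smul {ι κ : Type*} [Finite ι] [Finite κ] {C : Set E}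
    (hC : IsOpen C) (hne : C.Nonempty) (L : ι → Submodule ℝ E)
    (hL : ∀ k, Module.finrank ℝ (L k) + 3 ≤ Module.finrank ℝ E)
    (δ : κ → ℝ → E) (hδ : ∀ c, ContDiff ℝ 1 (δ c)) :
    ∃ p ∈ C, ∀ k c, ∀ w ∈ L k, ∀ r t : ℝ, p ≠ w + r • δ c t := by
  cases isEmpty_or_nonempty (ι × κ) with
  | inl he =>
    obtain ⟨p, hp⟩ := hne
    exact ⟨p, hp, fun k c => (he.false (k, c)).elim⟩
  | inr he =>
  let Φ : ∀ a : ι × κ, (L a.1 × ℝ × ℝ) → E := fun a x => (x.1 : E) + x.2.1 • δ a.2 x.2.2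
  have hΦ : ∀ a, ContDiff ℝ 1 (Φ a) := fun a => by
    have h1 : ContDiff ℝ 1 (fun x : L a.1 × ℝ × ℝ => (x.1 : E)) :=
      (L a.1).subtypeL.contDiff.comp contDiff_fst
    exact h1.add (contDiff_snd.fst.smul ((hδ a.2).comp contDiff_snd.snd))
  have hdim : dimH (⋃ a, range (Φ a)) < Module.finrank ℝ E := by
    rw [dimH_iUnion]
    obtain ⟨a, ha⟩ := exists_eq_ciSup_of_finite (f := fun a => dimH (range (Φ a)))
    rw [← ha]
    refine ((hΦ a).dimH_range_le).trans_lt (Nat.cast_lt.2 ?_)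
    have := hL a.1
    simp only [Module.finrank_prod, Module.finrank_self]
    omega
  obtain ⟨p, hp, hpC⟩ := (dense_compl_of_dimH_lt_finrank hdim).inter_open_nonempty C hC hne
  refine ⟨p, hp, fun k c w hw r t h => hpC ?_⟩
  exact mem_iUnion.2 ⟨(k, c), (⟨w, hw⟩, r, t), h.symm⟩

/-- Removing finitely many subspaces of codimension at least three from a convex open set leaves a
simply connected set. -/
theorem isSimplyConnected_diff_iUnion_submodule {ι : Type*} [Finite ι] {C : Set E}
    (hC : IsOpen C) (hconv : Convex ℝ C) (hne : C.Nonempty) (L : ι → Submodule ℝ E)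
    (hL : ∀ k, Module.finrank ℝ (L k) + 3 ≤ Module.finrank ℝ E) :
    IsSimplyConnected (C \ ⋃ k, (L k : Set E)) := by
  set X := C \ ⋃ k, (L k : Set E) with hX
  have hXo : IsOpen X :=
    hC.sdiff (isClosed_iUnion_of_finite fun k => (L k).closed_of_finiteDimensional)
  have hpc : IsPathConnected X := by
    rw [isPathConnected_iff]
    constructor
    · obtain ⟨p, hp, h⟩ := exists_mem_forall_ne_add_smul hC hne L hL
        (fun _ : Unit => fun _ : ℝ => (0 : E)) (fun _ => contDiff_const)
      refine ⟨p, hp, ?_⟩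
      rw [mem_iUnion, not_exists]
      intro k hk
      exact h k () p hk 0 0 (by simp)
    · intro a ha b hb
      obtain ⟨p, hp, h⟩ := exists_mem_forall_ne_add_smul hC hne L hL
        (fun c : Bool => fun _ : ℝ => cond c a b) (fun _ => contDiff_const)
      have h1 := segment_subset_diff_iUnion hconv hp ha (fun k w hw r => h k true w hw r 0)
      have h2 := segment_subset_diff_iUnion hconv hp hb (fun k w hw r => h k false w hw r 0)
      exact ((JoinedIn.of_segment_subset h1).symm).trans (JoinedIn.of_segment_subset h2)
  refine simply_connected_iff_loops_nullhomotopic.2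
    ⟨isPathConnected_iff_pathConnectedSpace.1 hpc, fun x γ => ?_⟩
  -- approximate the loop by a polynomial one
  let g : C(I, E) := ⟨fun t => (γ t : E), by fun_prop⟩
  have hg : range g ⊆ X := by rintro _ ⟨t, rfl⟩; exact (γ t).2
  obtain ⟨ε, hε, hball⟩ := (isCompact_range g.continuous).exists_thickening_subset_open hXo hg
  obtain ⟨N, hN0, hN⟩ : ∃ N : ℕ, N ≠ 0 ∧ ∀ t, dist (bernsteinApproximation N g t) (g t) < ε := by
    have h1 := (Metric.tendsto_nhds.1 (bernsteinApproximation_uniform g)) ε hε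
    obtain ⟨N, hN⟩ := (h1.and (Filter.eventually_ne_atTop 0)).exists
    exact ⟨N, hN.2, fun t => (ContinuousMap.dist_apply_le_dist t).trans_lt hN.1⟩
  let d : ℝ → E := fun t =>
    ∑ k : Fin (N + 1), (bernsteinPolynomial ℝ N k).eval t • g (bernstein.z k)
  have hd : ContDiff ℝ 1 d := by
    refine ContDiff.sum fun k _ => ContDiff.smul ?_ contDiff_const
    simpa using (bernsteinPolynomial ℝ N k).contDiff_aeval (𝕜 := ℝ) 1
  have hdb : ∀ t : I, bernsteinApproximation N g t = d t := fun t => by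
    rw [bernsteinApproximation.apply]; rfl
  have hseg : ∀ t : I, ∀ s : I, (1 - (s : ℝ)) • g t + (s : ℝ) • d t ∈ X := fun t s => by
    apply hball
    rw [Metric.mem_thickening_iff]
    refine ⟨g t, mem_range_self t, ?_⟩
    have h := hN t
    rw [hdb, dist_eq_norm] at h
    rw [dist_eq_norm]
    have : (1 - (s : ℝ)) • g t + (s : ℝ) • d t - g t = (s : ℝ) • (d t - g t) := by module
    rw [this, norm_smul, Real.norm_of_nonneg s.2.1]
    nlinarith [s.2.1, s.2.2, norm_nonneg (d t - g t)]
  have hdX : ∀ t : I, d t ∈ X := fun t => by simpa using hseg t 1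
  have hd0 : d 0 = x := by
    have := hdb 0
    rw [bernsteinApproximation.apply_zero] at this
    simpa [g] using this.symm
  have hd1 : d 1 = x := by
    have := hdb 1
    rw [bernsteinApproximation.apply_one hN0] at this
    simpa [g] using this.symm
  let δ : Path x x :=
    { toFun := fun t => ⟨d t, hdX t⟩
      continuous_toFun := by have := hd.continuous; fun_prop
      source' := Subtype.ext (by simpa using hd0)
      target' := Subtype.ext (by simpa using hd1) }
  have h1 : Path.Homotopic γ δ := by
    refine ⟨⟨⟨⟨fun q => ⟨(1 - (q.1 : ℝ)) • g q.2 + (q.1 : ℝ) • d q.2, hseg q.2 q.1⟩, ?_⟩,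
      ?_, ?_⟩, ?_⟩⟩
    · have := hd.continuous
      fun_prop
    · intro t; simp [g]
    · intro t; simp [δ]
    · rintro s t (rfl | rfl)
      · ext; simp [g, hd0]; module
      · ext; simp [g, hd1]; module
  refine h1.trans ?_
  -- cone off the polynomial loop
  obtain ⟨p, hp, h⟩ := exists_mem_forall_ne_add_smul hC hne L hL (fun _ : Unit => d) (fun _ => hd)
  let K : Set E := ⋃ t : I, segment ℝ p (d t)
  have hKX : K ⊆ X := iUnion_subset fun t =>
    segment_subset_diff_iUnion hconv hp (hdX t) (fun k w hw r => h k () w hw r t)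
  have hdK : ∀ t : I, d t ∈ K := fun t => mem_iUnion.2 ⟨t, right_mem_segment _ _ _⟩
  have hKs : StarConvex ℝ p K := starConvex_iUnion fun t =>
    (convex_segment p (d t)).starConvex (left_mem_segment _ _ _)
  have : ContractibleSpace K := hKs.contractibleSpace ⟨d 0, hdK 0⟩
  let x' : K := ⟨x, hd0 ▸ hdK 0⟩
  let δ' : Path x' x' :=
    { toFun := fun t => ⟨d t, hdK t⟩
      continuous_toFun := by have := hd.continuous; fun_prop
      source' := Subtype.ext (by simpa using hd0)
      target' := Subtype.ext (by simpa using hd1) }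
  have h2 : Path.Homotopic δ' (Path.refl x') := SimplyConnectedSpace.paths_homotopic _ _
  exact h2.map ⟨inclusion hKX, continuous_inclusion hKX⟩

end GeneralPosition

section ConformalBarycenter

open Set Topology
open Complex ComplexConjugate

/-- The point of the unit circle obtained by doubling the angle of `z`. -/
noncomputable def dir (z : ℂ) : ℂ := z / conj z

/-- The linear map of the plane sending `i` to `i` and `1` to `ε - b i`. -/
def shear (b ε : ℝ) (z : ℂ) : ℂ := ⟨ε * z.re, z.im - b * z.re⟩

theorem dir_re (z : ℂ) : (dir z).re = (z.re ^ 2 - z.im ^ 2) / normSq z := by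
  simp only [dir, div_re, conj_re, conj_im, normSq_conj]
  ring

theorem dir_im (z : ℂ) : (dir z).im = 2 * z.re * z.im / normSq z := by
  simp only [dir, div_im, conj_re, conj_im, normSq_conj]
  ring

theorem norm_dir {z : ℂ} (hz : z ≠ 0) : ‖dir z‖ = 1 := by
  rw [dir, norm_div, RCLike.norm_conj, div_self (norm_ne_zero_iff.2 hz)]

theorem dir_real_smul {r : ℝ} (hr : r ≠ 0) (z : ℂ) : dir (r * z) = dir z := by
  rw [dir, map_mul, conj_ofReal, mul_div_mul_left _ _ (ofReal_ne_zero.2 hr), dir]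

theorem continuousAt_dir {z : ℂ} (hz : z ≠ 0) : ContinuousAt dir z :=
  continuousAt_id.div continuous_conj.continuousAt (by simpa using hz)

theorem shear_ne_zero {b ε : ℝ} (hε : ε ≠ 0) {z : ℂ} (hz : z ≠ 0) : shear b ε z ≠ 0 := by
  intro h
  have h1 : ε * z.re = 0 := congrArg re h
  have h2 : z.im - b * z.re = 0 := congrArg im h
  have h3 : z.re = 0 := (mul_eq_zero.1 h1).resolve_left hε
  exact hz (Complex.ext h3 (by simpa [h3] using h2))

theorem shear_shear (b ε b' ε' : ℝ) (z : ℂ) :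
    shear b' ε' (shear b ε z) = shear (b + b' * ε) (ε' * ε) z := by
  simp only [shear, Complex.ext_iff]
  constructor <;> ring

theorem shear_zero_one (z : ℂ) : shear 0 1 z = z := by
  simp [shear]

variable {κ : Type*} [Fintype κ]

/-- Nonzero vectors `w k` with weights `ω k`, one of them being `i`, are stable if parallel ones
always carry less than half of the total weight. -/
structure IsStable (ω : κ → ℝ) (o : κ) (w : κ → ℂ) : Prop where
  eq_I : w o = I
  ne_zero : ∀ k, w k ≠ 0
  lt : ∀ J : Finset κ, (∀ j ∈ J, ∀ k ∈ J, (w j).re * (w k).im = (w k).re * (w j).im) →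
    2 * ∑ k ∈ J, ω k < ∑ k, ω k

theorem IsStable.shear {ω : κ → ℝ} {o : κ} {w : κ → ℂ} (h : IsStable ω o w) (b : ℝ) {ε : ℝ}
    (hε : ε ≠ 0) : IsStable ω o fun k => shear b ε (w k) where
  eq_I := by simp [_root_.shear, h.eq_I, Complex.ext_iff]
  ne_zero k := shear_ne_zero hε (h.ne_zero k)
  lt J hJ := h.lt J fun j hj k hk => by
    have := hJ j hj k hk
    simp only [_root_.shear] at this
    refine mul_left_cancel₀ hε ?_
    linear_combination this

theorem IsStable.eq_zero_and_eq_one {ω : κ → ℝ} (hω : ∀ k, 0 < ω k) {o : κ} {w : κ → ℂ}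
    (h : IsStable ω o w) {b ε : ℝ} (hε : 0 < ε) (h1 : ∑ k, (ω k : ℂ) * dir (w k) = 0)
    (h2 : ∑ k, (ω k : ℂ) * dir (_root_.shear b ε (w k)) = 0) : b = 0 ∧ ε = 1 := by
  have hr1 := congrArg re h1
  have hi1 := congrArg im h1
  have hr2 := congrArg re h2
  have hi2 := congrArg im h2
  simp only [re_sum, im_sum, re_ofReal_mul, im_ofReal_mul, dir_re, dir_im, zero_re, zero_im]
    at hr1 hi1 hr2 hi2
  set S : κ → ℝ := fun k => normSq (w k) with hS
  set Q : κ → ℝ := fun k => normSq (_root_.shear b ε (w k)) with hQ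
  have hSpos : ∀ k, 0 < S k := fun k => normSq_pos.2 (h.ne_zero k)
  have hQpos : ∀ k, 0 < Q k := fun k => normSq_pos.2 (shear_ne_zero hε.ne' (h.ne_zero k))
  have hS' : ∀ k, S k = (w k).re ^ 2 + (w k).im ^ 2 := fun k => by
    simp only [hS, normSq_apply]; ring
  have hQ' : ∀ k, Q k = (ε * (w k).re) ^ 2 + ((w k).im - b * (w k).re) ^ 2 := fun k => by
    simp only [hQ, normSq_apply, _root_.shear]; ring
  set c : ℝ := 1 + b ^ 2 + ε ^ 2 with hc
  have e1 : ∀ k, Q k / S k = c / 2 + (ε ^ 2 + b ^ 2 - 1) / 2 * (((w k).re ^ 2 - (w k).im ^ 2) / S k)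
      - b * (2 * (w k).re * (w k).im / S k) := by
    intro k
    have := (hSpos k).ne'
    field_simp
    rw [hQ', hS', hc]
    ring
  have e2 : ∀ k, ε ^ 2 * (S k / Q k) = c / 2
      + (1 + b ^ 2 - ε ^ 2) / 2 * (((_root_.shear b ε (w k)).re ^ 2
        - (_root_.shear b ε (w k)).im ^ 2) / Q k)
      + b * ε * (2 * (_root_.shear b ε (w k)).re * (_root_.shear b ε (w k)).im / Q k) := by
    intro k
    have := (hQpos k).ne'
    field_simp
    rw [hQ', hS', hc]
    simp only [_root_.shear]
    ring
  have s1 : ∑ k, ω k * (Q k / S k) = (∑ k, ω k) * (c / 2) := by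
    calc _ = (∑ k, ω k) * (c / 2) + (ε ^ 2 + b ^ 2 - 1) / 2 *
          (∑ k, ω k * (((w k).re ^ 2 - (w k).im ^ 2) / S k)) -
          b * ∑ k, ω k * (2 * (w k).re * (w k).im / S k) := by
          rw [Finset.sum_mul, Finset.mul_sum, Finset.mul_sum, ← Finset.sum_add_distrib,
            ← Finset.sum_sub_distrib]
          refine Finset.sum_congr rfl fun k _ => ?_
          rw [e1]
          ring
      _ = _ := by rw [hr1, hi1]; ring
  have s2 : ∑ k, ω k * (ε ^ 2 * (S k / Q k)) = (∑ k, ω k) * (c / 2) := by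
    calc _ = (∑ k, ω k) * (c / 2) + (1 + b ^ 2 - ε ^ 2) / 2 *
          (∑ k, ω k * (((_root_.shear b ε (w k)).re ^ 2
            - (_root_.shear b ε (w k)).im ^ 2) / Q k)) +
          b * ε * ∑ k, ω k *
            (2 * (_root_.shear b ε (w k)).re * (_root_.shear b ε (w k)).im / Q k) := by
          rw [Finset.sum_mul, Finset.mul_sum, Finset.mul_sum, ← Finset.sum_add_distrib,
            ← Finset.sum_add_distrib]
          refine Finset.sum_congr rfl fun k _ => ?_
          rw [e2]
          ring
      _ = _ := by rw [hr2, hi2]; ring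
  have hle : ∀ k, Q k / S k + ε ^ 2 * (S k / Q k) ≤ c := by
    intro k
    have := hSpos k
    have := hQpos k
    rw [div_add' _ _ _ (hSpos k).ne', div_le_iff₀ (hSpos k)]
    have h3 : ε ^ 2 * (S k / Q k) * S k = (ε * S k) ^ 2 / Q k := by
      field_simp
    rw [h3, add_div' _ _ _ (hQpos k).ne', div_le_iff₀ (hQpos k)]
    rw [hQ', hS', hc]
    nlinarith [sq_nonneg ((1 - ε ^ 2 - b ^ 2) * (w k).re * (w k).im
      + b * ((w k).im ^ 2 - (w k).re ^ 2))]
  have heq : ∀ k, Q k / S k + ε ^ 2 * (S k / Q k) = c := by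
    have h0 : ∑ k, ω k * (c - (Q k / S k + ε ^ 2 * (S k / Q k))) = 0 := by
      simp only [mul_sub, mul_add, Finset.sum_sub_distrib, Finset.sum_add_distrib, s1, s2,
        ← Finset.sum_mul]
      ring
    intro k
    have := (Finset.sum_eq_zero_iff_of_nonneg fun k _ =>
      mul_nonneg (hω k).le (sub_nonneg.2 (hle k))).1 h0 k (Finset.mem_univ k)
    linarith [(mul_eq_zero.1 this).resolve_left (hω k).ne']
  have hb : b = 0 := by
    have ho := heq o
    rw [hQ', hS', h.eq_I, hc] at ho
    simp at ho
    nlinarith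
  subst hb
  refine ⟨rfl, ?_⟩
  by_contra hε1
  have hprod : ∀ k, (w k).re = 0 ∨ (w k).im = 0 := by
    intro k
    have hk := heq k
    have h1 := (hSpos k).ne'
    have h2 := (hQpos k).ne'
    field_simp at hk
    rw [hQ', hS', hc] at hk
    have : (ε ^ 2 - 1) ^ 2 * ((w k).re * (w k).im) ^ 2 = 0 := by
      linear_combination -hk
    have h4 : ε ^ 2 - 1 ≠ 0 := by
      intro h4
      apply hε1
      nlinarith
    have := pow_eq_zero_iff two_ne_zero |>.1
      ((mul_eq_zero.1 this).resolve_left (pow_ne_zero 2 h4))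
    exact mul_eq_zero.1 this
  have l1 := h.lt ({k | (w k).re = 0} : Finset κ) (by simp +contextual)
  have l2 := h.lt ({k | ¬ (w k).re = 0} : Finset κ) (by
    intro j hj k hk
    rw [Finset.mem_filter] at hj hk
    rw [(hprod j).resolve_left hj.2, (hprod k).resolve_left hk.2]
    simp)
  have := Finset.sum_filter_add_sum_filter_not Finset.univ (fun k => (w k).re = 0) ω
  linarith

theorem hasDerivAt_normSq_shear_left (b ε : ℝ) (z : ℂ) :
    HasDerivAt (fun b => normSq (shear b ε z)) (-2 * z.re * (z.im - b * z.re)) b := by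
  have h1 : HasDerivAt (fun b : ℝ => z.im - b * z.re) (-z.re) b := by
    simpa using ((hasDerivAt_id b).mul_const z.re).const_sub z.im
  have h2 := (h1.pow 2).const_add ((ε * z.re) ^ 2)
  refine (h2.congr_deriv (by simp; ring)).congr_of_eventuallyEq (.of_forall fun t => ?_)
  simp only [normSq_apply, shear, Pi.pow_apply]
  ring

theorem hasDerivAt_normSq_shear_right (b a : ℝ) (z : ℂ) :
    HasDerivAt (fun a => normSq (shear b (Real.exp a) z)) (2 * (Real.exp a * z.re) ^ 2) a := by
  have h1 : HasDerivAt (fun a : ℝ => Real.exp a * z.re) (Real.exp a * z.re) a :=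
    (Real.hasDerivAt_exp a).mul_const z.re
  have h2 := (h1.pow 2).add_const ((z.im - b * z.re) ^ 2)
  refine (h2.congr_deriv (by simp; ring)).congr_of_eventuallyEq (.of_forall fun t => ?_)
  simp only [normSq_apply, shear, Pi.pow_apply]
  ring

theorem sum_mul_dir_shear_eq_zero_of_isMinOn {ω : κ → ℝ} {w : κ → ℂ} (hw : ∀ k, w k ≠ 0) {b a : ℝ}
    (hmin : ∀ b' a', ∑ k, ω k * Real.log (normSq (shear b (Real.exp a) (w k))) - (∑ k, ω k) * a ≤
      ∑ k, ω k * Real.log (normSq (shear b' (Real.exp a') (w k))) - (∑ k, ω k) * a') :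
    ∑ k, (ω k : ℂ) * dir (shear b (Real.exp a) (w k)) = 0 := by
  have hne : ∀ k, normSq (shear b (Real.exp a) (w k)) ≠ 0 := fun k =>
    (normSq_pos.2 (shear_ne_zero (Real.exp_pos a).ne' (hw k))).ne'
  have d1 : HasDerivAt (fun b' => ∑ k, ω k * Real.log (normSq (shear b' (Real.exp a) (w k)))
      - (∑ k, ω k) * a) _ b :=
    (HasDerivAt.fun_sum fun k _ => (((hasDerivAt_normSq_shear_left b (Real.exp a) (w k)).log
      (hne k)).const_mul (ω k))).sub_const _
  have d2 : HasDerivAt (fun a' => ∑ k, ω k * Real.log (normSq (shear b (Real.exp a') (w k)))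
      - (∑ k, ω k) * a') _ a :=
    (HasDerivAt.fun_sum fun k _ => (((hasDerivAt_normSq_shear_right b a (w k)).log
      (hne k)).const_mul (ω k))).sub ((hasDerivAt_id a).const_mul _)
  have z1 := IsLocalMin.hasDerivAt_eq_zero (.of_forall fun b' => hmin b' a) d1
  have z2 := IsLocalMin.hasDerivAt_eq_zero (.of_forall fun a' => hmin b a') d2
  apply Complex.ext
  · simp only [re_sum, re_ofReal_mul, dir_re, zero_re]
    rw [← z2, mul_one, ← Finset.sum_sub_distrib]
    refine Finset.sum_congr rfl fun k _ => ?_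
    have := hne k
    field_simp
    simp only [normSq_apply, shear]
    ring
  · simp only [im_sum, im_ofReal_mul, dir_im, zero_im]
    rw [← mul_zero (-Real.exp a), ← z1, Finset.mul_sum]
    refine Finset.sum_congr rfl fun k _ => ?_
    simp only [shear]
    ring

theorem mul_normSq_le_normSq_shear_mul (b ε : ℝ) (z : ℂ) :
    ε ^ 2 * normSq z ≤ normSq (shear b ε z) * (1 + b ^ 2 + ε ^ 2) := by
  simp only [normSq_apply, shear]
  nlinarith [sq_nonneg (ε ^ 2 * z.re + b * (b * z.re - z.im)), sq_nonneg (z.im - b * z.re),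
    sq_nonneg (ε * (b * z.im + z.re)), sq_nonneg (ε ^ 2 * z.re), sq_nonneg (b * (b * z.re - z.im)),
    sq_nonneg (b * z.im - b * b * z.re + z.re), sq_nonneg (ε * z.im)]

theorem det_sq_mul_le (b ε : ℝ) (z w : ℂ) :
    (z.re * w.im - w.re * z.im) ^ 2 * (1 + b ^ 2 + ε ^ 2) ≤
      2 * (normSq w * normSq (shear b ε z) + normSq z * normSq (shear b ε w)) := by
  simp only [normSq_apply, shear]
  nlinarith [sq_nonneg (w.re * (ε * z.re) + z.re * (ε * w.re)),
    sq_nonneg (w.re * (z.im - b * z.re) + z.re * (w.im - b * w.re)),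
    sq_nonneg (w.im * (ε * z.re) + z.im * (ε * w.re)),
    sq_nonneg (w.im * (z.im - b * z.re) + z.im * (w.im - b * w.re))]

theorem IsStable.exists_bound {ω : κ → ℝ} (hω : ∀ k, 0 < ω k) {o : κ} {w : κ → ℂ}
    (h : IsStable ω o w) (F : ℝ) :
    ∃ B : ℝ, ∀ b a, ∑ k, ω k * Real.log (normSq (_root_.shear b (Real.exp a) (w k)))
      - (∑ k, ω k) * a ≤ F → (1 + b ^ 2 + Real.exp a ^ 2) / Real.exp a ≤ B := by
  classical
  have hS : ∀ k, 0 < normSq (w k) := fun k => normSq_pos.2 (h.ne_zero k)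
  obtain ⟨δ, hδ, hδ0⟩ : ∃ δ : ℝ, (∀ j k, (w j).re * (w k).im - (w k).re * (w j).im ≠ 0 →
      2 * δ * (normSq (w k) + normSq (w j)) < ((w j).re * (w k).im - (w k).re * (w j).im) ^ 2) ∧
      0 < δ := by
    have h1 : ∀ᶠ δ : ℝ in 𝓝[>] 0, ∀ j k, (w j).re * (w k).im - (w k).re * (w j).im ≠ 0 →
      2 * δ * (normSq (w k) + normSq (w j)) <
        ((w j).re * (w k).im - (w k).re * (w j).im) ^ 2 := by
      simp only [Filter.eventually_all]
      intro j k hjk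
      have hc : Continuous fun δ : ℝ => 2 * δ * (normSq (w k) + normSq (w j)) := by fun_prop
      refine (hc.tendsto 0).mono_left nhdsWithin_le_nhds |>.eventually_lt_const ?_
      simpa using sq_pos_of_ne_zero hjk
    exact (h1.and self_mem_nhdsWithin).exists
  have key : ∀ J : Finset κ, ∃ B : ℝ, ∀ b a,
      ∑ k, ω k * Real.log (normSq (_root_.shear b (Real.exp a) (w k))) - (∑ k, ω k) * a ≤ F →
      J = ({k | normSq (_root_.shear b (Real.exp a) (w k)) < δ * (1 + b ^ 2 + Real.exp a ^ 2)} :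
        Finset κ) → (1 + b ^ 2 + Real.exp a ^ 2) / Real.exp a ≤ B := by
    intro J
    by_cases hJ : ∀ j ∈ J, ∀ k ∈ J, (w j).re * (w k).im = (w k).re * (w j).im
    · have hg : 0 < ∑ k, ω k - 2 * ∑ k ∈ J, ω k := sub_pos.2 (h.lt J hJ)
      refine ⟨Real.exp ((F - (∑ k ∈ J, ω k * Real.log (normSq (w k)) +
        ∑ k ∈ Jᶜ, ω k * Real.log δ)) / (∑ k, ω k - 2 * ∑ k ∈ J, ω k)), ?_⟩
      intro b a hF hJe
      set ε := Real.exp a with hε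
      have hε0 : 0 < ε := Real.exp_pos a
      set R := 1 + b ^ 2 + ε ^ 2 with hR
      have hR0 : 0 < R := by positivity
      have hQ : ∀ k, 0 < normSq (_root_.shear b ε (w k)) := fun k =>
        normSq_pos.2 (shear_ne_zero hε0.ne' (h.ne_zero k))
      rw [← Real.log_le_iff_le_exp (by positivity), le_div_iff₀ hg,
        Real.log_div hR0.ne' hε0.ne', hε, Real.log_exp]
      have l1 : ∀ k, Real.log (normSq (w k)) + 2 * a - Real.log R ≤
          Real.log (normSq (_root_.shear b ε (w k))) := by
        intro k
        have := Real.log_le_log (mul_pos (pow_pos hε0 2) (hS k))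
          (mul_normSq_le_normSq_shear_mul b ε (w k))
        rw [Real.log_mul (pow_pos hε0 2).ne' (hS k).ne', Real.log_mul (hQ k).ne' hR0.ne',
          Real.log_pow, hε, Real.log_exp] at this
        push_cast at this
        linarith
      have l2 : ∀ k ∈ Jᶜ, Real.log δ + Real.log R ≤
          Real.log (normSq (_root_.shear b ε (w k))) := by
        intro k hk
        rw [hJe] at hk
        simp only [Finset.mem_compl, Finset.mem_filter, Finset.mem_univ, true_and, not_lt] at hk
        rw [← Real.log_mul hδ0.ne' hR0.ne']
        exact Real.log_le_log (by positivity) hk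
      have m1 : ∑ k ∈ J, ω k * (Real.log (normSq (w k)) + 2 * a - Real.log R) ≤
          ∑ k ∈ J, ω k * Real.log (normSq (_root_.shear b ε (w k))) :=
        Finset.sum_le_sum fun k _ => mul_le_mul_of_nonneg_left (l1 k) (hω k).le
      have m2 : ∑ k ∈ Jᶜ, ω k * (Real.log δ + Real.log R) ≤
          ∑ k ∈ Jᶜ, ω k * Real.log (normSq (_root_.shear b ε (w k))) :=
        Finset.sum_le_sum fun k hk => mul_le_mul_of_nonneg_left (l2 k hk) (hω k).le
      have m3 := Finset.sum_add_sum_compl J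
        fun k => ω k * Real.log (normSq (_root_.shear b ε (w k)))
      have m4 := Finset.sum_add_sum_compl J ω
      simp only [mul_add, mul_sub, Finset.sum_add_distrib, Finset.sum_sub_distrib,
        ← Finset.sum_mul] at m1 m2 ⊢
      rw [← m3] at hF
      rw [← m4] at hF ⊢
      nlinarith
    · refine ⟨0, fun b a _ hJe => (hJ ?_).elim⟩
      intro j hj k hk
      rw [hJe, Finset.mem_filter] at hj hk
      by_contra hjk
      have h1 := hδ j k (sub_ne_zero.2 hjk)
      have h2 := det_sq_mul_le b (Real.exp a) (w j) (w k)
      have hR0 : 0 < 1 + b ^ 2 + Real.exp a ^ 2 := by positivity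
      have h3 := mul_lt_mul_of_pos_left hj.2 (hS k)
      have h4 := mul_lt_mul_of_pos_left hk.2 (hS j)
      nlinarith [mul_lt_mul_of_pos_right h1 hR0]
  choose B hB using key
  refine ⟨∑ J, |B J|, fun b a hF => (hB _ b a hF rfl).trans ((le_abs_self _).trans ?_)⟩
  exact Finset.single_le_sum (f := fun J => |B J|) (fun J _ => abs_nonneg _) (Finset.mem_univ _)

theorem IsStable.exists_balanced {ω : κ → ℝ} (hω : ∀ k, 0 < ω k) {o : κ} {w : κ → ℂ}
    (h : IsStable ω o w) :
    ∃ b ε, 0 < ε ∧ ∑ k, (ω k : ℂ) * dir (_root_.shear b ε (w k)) = 0 := by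
  set F : ℝ × ℝ → ℝ := fun v =>
    ∑ k, ω k * Real.log (normSq (_root_.shear v.1 (Real.exp v.2) (w k))) - (∑ k, ω k) * v.2 with hF
  have hcont : Continuous F := by
    have : ∀ k, Continuous fun v : ℝ × ℝ =>
        Real.log (normSq (_root_.shear v.1 (Real.exp v.2) (w k))) := fun k => by
      refine Continuous.log ?_ fun v =>
        (normSq_pos.2 (shear_ne_zero (Real.exp_pos v.2).ne' (h.ne_zero k))).ne'
      simp only [normSq_apply, _root_.shear]
      fun_prop
    fun_prop
  obtain ⟨B, hB⟩ := h.exists_bound hω (F 0)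
  have hbox : ∀ v, F v ≤ F 0 → v ∈ Icc (-B) B ×ˢ Icc (-B) B := by
    intro v hv
    have h1 := hB v.1 v.2 hv
    have he := Real.exp_pos v.2
    rw [div_le_iff₀ he] at h1
    have h2 : Real.exp v.2 ≤ B := by nlinarith [sq_nonneg v.1]
    have h3 : 1 ≤ B * Real.exp v.2 := by nlinarith [sq_nonneg v.1]
    have h5 : v.1 ^ 2 ≤ B ^ 2 := by nlinarith [sq_nonneg v.1]
    have h6 := abs_le.1 (abs_le_of_sq_le_sq h5 (he.le.trans h2))
    have h7 : Real.exp (-v.2) ≤ B := by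
      rw [Real.exp_neg, inv_le_iff_one_le_mul₀ he]
      exact h3
    refine ⟨⟨h6.1, h6.2⟩, ?_, ?_⟩
    · linarith [Real.add_one_le_exp (-v.2)]
    · linarith [Real.add_one_le_exp v.2]
  obtain ⟨m, hm, hmin⟩ := (isCompact_Icc.prod isCompact_Icc).exists_isMinOn
    ⟨0, hbox 0 le_rfl⟩ hcont.continuousOn
  have hglob : ∀ v, F m ≤ F v := by
    intro v
    by_cases hv : F v ≤ F 0
    · exact hmin (hbox v hv)
    · exact (hmin (hbox 0 le_rfl)).trans (not_le.1 hv).le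
  exact ⟨m.1, Real.exp m.2, Real.exp_pos _,
    sum_mul_dir_shear_eq_zero_of_isMinOn h.ne_zero fun b' a' => hglob (b', a')⟩

theorem norm_dir_le_one (z : ℂ) : ‖dir z‖ ≤ 1 := by
  rcases eq_or_ne z 0 with rfl | hz
  · simp [dir]
  · exact (norm_dir hz).le

theorem IsStable.exists_tendsto {ω : κ → ℝ} (hω : ∀ k, 0 < ω k) {o : κ} {w₀ : κ → ℂ}
    (h : IsStable ω o w₀) {S : Type*} (𝒰 : Ultrafilter S) {w : S → κ → ℂ} {b ε : S → ℝ}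
    (hw : Filter.Tendsto w 𝒰 (𝓝 w₀)) (hε : ∀ᶠ s in (𝒰 : Filter S), 0 < ε s)
    (hbal : ∀ᶠ s in (𝒰 : Filter S),
      ∑ k, (ω k : ℂ) * dir (_root_.shear (b s) (ε s) (w s k)) = 0) :
    ∃ b₀ ε₀, 0 < ε₀ ∧ Filter.Tendsto b 𝒰 (𝓝 b₀) ∧ Filter.Tendsto ε 𝒰 (𝓝 ε₀) ∧
      ∑ k, (ω k : ℂ) * dir (_root_.shear b₀ ε₀ (w₀ k)) = 0 := by
  set R : S → ℝ := fun s => √(1 + b s ^ 2 + ε s ^ 2) with hR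
  have hR2 : ∀ s, R s ^ 2 = 1 + b s ^ 2 + ε s ^ 2 := fun s => Real.sq_sqrt (by positivity)
  have hR0 : ∀ s, 0 < R s := fun s => Real.sqrt_pos.2 (by positivity)
  have hlim : ∀ f : S → ℝ, (∀ s, f s ^ 2 ≤ R s ^ 2) →
      ∃ x, Filter.Tendsto (fun s => f s / R s) 𝒰 (𝓝 x) := by
    intro f hf
    have hmem : ∀ s, f s / R s ∈ Icc (-1 : ℝ) 1 := fun s => by
      rw [mem_Icc, ← abs_le, abs_div, abs_of_pos (hR0 s), div_le_one (hR0 s)]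
      exact abs_le_of_sq_le_sq (hf s) (hR0 s).le
    obtain ⟨x, -, hx⟩ := isCompact_Icc.ultrafilter_le_nhds (𝒰.map fun s => f s / R s)
      (Filter.le_principal_iff.2 (Filter.mem_map.2 (Filter.univ_mem' hmem)))
    exact ⟨x, hx⟩
  obtain ⟨α, hα⟩ := hlim ε fun s => by rw [hR2]; nlinarith [sq_nonneg (b s)]
  obtain ⟨γ, hγ⟩ := hlim b fun s => by rw [hR2]; nlinarith [sq_nonneg (ε s)]
  obtain ⟨β, hβ⟩ := hlim (fun _ => 1) fun s => by
    rw [hR2]; nlinarith [sq_nonneg (ε s), sq_nonneg (b s)]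
  have hsum : α ^ 2 + γ ^ 2 + β ^ 2 = 1 := by
    refine tendsto_nhds_unique (((hα.pow 2).add (hγ.pow 2)).add (hβ.pow 2))
      (tendsto_const_nhds.congr fun s => ?_)
    have := (hR0 s).ne'
    field_simp
    rw [hR2]
    ring
  have hwk : ∀ k, Filter.Tendsto (fun s => w s k) 𝒰 (𝓝 (w₀ k)) := fun k =>
    (continuous_apply k).continuousAt.tendsto.comp hw
  set z₀ : κ → ℂ := fun k => ⟨α * (w₀ k).re, β * (w₀ k).im - γ * (w₀ k).re⟩ with hz₀
  have hdir : ∀ k, z₀ k ≠ 0 →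
      Filter.Tendsto (fun s => dir (_root_.shear (b s) (ε s) (w s k))) 𝒰 (𝓝 (dir (z₀ k))) := by
    intro k hk
    have hre : Filter.Tendsto (fun s => (w s k).re) 𝒰 (𝓝 (w₀ k).re) :=
      continuous_re.continuousAt.tendsto.comp (hwk k)
    have him : Filter.Tendsto (fun s => (w s k).im) 𝒰 (𝓝 (w₀ k).im) :=
      continuous_im.continuousAt.tendsto.comp (hwk k)
    have h1 : Filter.Tendsto (fun s => ((R s)⁻¹ : ℝ) * _root_.shear (b s) (ε s) (w s k)) 𝒰
        (𝓝 (z₀ k)) := by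
      have h2 : Filter.Tendsto (fun s => ((ε s / R s * (w s k).re : ℝ) : ℂ) +
          ((1 / R s * (w s k).im - b s / R s * (w s k).re : ℝ) : ℂ) * I) 𝒰
          (𝓝 (((α * (w₀ k).re : ℝ) : ℂ) + ((β * (w₀ k).im - γ * (w₀ k).re : ℝ) : ℂ) * I)) :=
        (continuous_ofReal.continuousAt.tendsto.comp (hα.mul hre)).add
          ((continuous_ofReal.continuousAt.tendsto.comp
            ((hβ.mul him).sub (hγ.mul hre))).mul_const I)
      rw [← mk_eq_add_mul_I] at h2
      refine h2.congr fun s => ?_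
      rw [← mk_eq_add_mul_I]
      apply Complex.ext
      · simp only [re_ofReal_mul, _root_.shear]; ring
      · simp only [im_ofReal_mul, _root_.shear]; ring
    refine ((continuousAt_dir hk).tendsto.comp h1).congr fun s => ?_
    exact dir_real_smul (inv_pos.2 (hR0 s)).ne' _
  have hα0 : 0 ≤ α := ge_of_tendsto hα (hε.mono fun s hs => (div_pos hs (hR0 s)).le)
  have hβ0 : 0 ≤ β := ge_of_tendsto hβ (.of_forall fun s => (one_div_pos.2 (hR0 s)).le)
  by_cases hαβ : α * β = 0
  · exfalso
    obtain ⟨d, hd1, hd⟩ : ∃ d : ℂ, ‖d‖ = 1 ∧ ∀ k, z₀ k ≠ 0 → dir (z₀ k) = d := by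
      rcases mul_eq_zero.1 hαβ with h0 | h0
      · refine ⟨dir I, norm_dir I_ne_zero, fun k hk => ?_⟩
        have h1 : z₀ k = ((β * (w₀ k).im - γ * (w₀ k).re : ℝ) : ℂ) * I := by
          simp [hz₀, h0, Complex.ext_iff]
        rw [h1] at hk ⊢
        exact dir_real_smul (ofReal_ne_zero.1 (left_ne_zero_of_mul hk)) I
      · have h2 : (⟨α, -γ⟩ : ℂ) ≠ 0 := by
          intro h2
          have h3 : α = 0 := congrArg re h2
          have h4 : -γ = 0 := congrArg im h2
          rw [neg_eq_zero] at h4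
          simp [h0, h3, h4] at hsum
        refine ⟨dir ⟨α, -γ⟩, norm_dir h2, fun k hk => ?_⟩
        have h1 : z₀ k = (((w₀ k).re : ℝ) : ℂ) * ⟨α, -γ⟩ := by
          simp [hz₀, h0, Complex.ext_iff, mul_comm]
        rw [h1] at hk ⊢
        exact dir_real_smul (ofReal_ne_zero.1 (left_ne_zero_of_mul hk)) _
    classical
    set J : Finset κ := {k | z₀ k = 0} with hJ
    have hlt := h.lt J <| by
      intro j hj k hk
      rw [hJ, Finset.mem_filter] at hj hk
      have j1 : α * (w₀ j).re = 0 := congrArg re hj.2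
      have k1 : α * (w₀ k).re = 0 := congrArg re hk.2
      have j2 : β * (w₀ j).im - γ * (w₀ j).re = 0 := congrArg im hj.2
      have k2 : β * (w₀ k).im - γ * (w₀ k).re = 0 := congrArg im hk.2
      have e : (α ^ 2 + γ ^ 2 + β ^ 2) * ((w₀ j).re * (w₀ k).im - (w₀ k).re * (w₀ j).im) = 0 := by
        linear_combination (α * (w₀ k).im) * j1 - (α * (w₀ j).im) * k1 +
          (β * (w₀ j).re) * k2 - (β * (w₀ k).re) * j2 +
          (γ * (w₀ j).im) * k2 - (γ * (w₀ k).im) * j2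
      rw [hsum, one_mul] at e
      linarith
    have t1 : Filter.Tendsto
        (fun s => ‖∑ k ∈ Jᶜ, (ω k : ℂ) * dir (_root_.shear (b s) (ε s) (w s k))‖) 𝒰
        (𝓝 ‖∑ k ∈ Jᶜ, (ω k : ℂ) * d‖) := by
      refine (tendsto_finsetSum _ fun k hk => ?_).norm
      have hk : z₀ k ≠ 0 := by simpa [hJ] using hk
      rw [← hd k hk]
      exact (hdir k hk).const_mul _
    have t2 : ‖∑ k ∈ Jᶜ, (ω k : ℂ) * d‖ ≤ ∑ k ∈ J, ω k := by
      refine le_of_tendsto t1 (hbal.mono fun s hs => ?_)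
      rw [← Finset.sum_add_sum_compl J] at hs
      rw [← norm_neg, ← eq_neg_of_add_eq_zero_left hs]
      refine norm_sum_le_of_le _ fun k _ => ?_
      rw [norm_mul, norm_real, Real.norm_of_nonneg (hω k).le]
      exact mul_le_of_le_one_right (hω k).le (norm_dir_le_one _)
    rw [← Finset.sum_mul, norm_mul, hd1, mul_one, ← ofReal_sum, norm_real,
      Real.norm_of_nonneg (Finset.sum_nonneg fun k _ => (hω k).le)] at t2
    have := Finset.sum_add_sum_compl J ω
    linarith
  · have hα1 : 0 < α := hα0.lt_of_ne' (left_ne_zero_of_mul hαβ)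
    have hβ1 : 0 < β := hβ0.lt_of_ne' (right_ne_zero_of_mul hαβ)
    have hzs : ∀ k, z₀ k = (β : ℂ) * _root_.shear (γ / β) (α / β) (w₀ k) := by
      intro k
      apply Complex.ext
      · simp only [hz₀, re_ofReal_mul, _root_.shear]; field_simp
      · simp only [hz₀, im_ofReal_mul, _root_.shear]; field_simp
    refine ⟨γ / β, α / β, div_pos hα1 hβ1, ?_, ?_, ?_⟩
    · refine (hγ.div hβ hβ1.ne').congr fun s => ?_
      have := (hR0 s).ne'
      simp only [Pi.div_apply]
      field_simp
    · refine (hα.div hβ hβ1.ne').congr fun s => ?_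
      have := (hR0 s).ne'
      simp only [Pi.div_apply]
      field_simp
    · have hz : ∀ k, z₀ k ≠ 0 := fun k => by
        rw [hzs]
        exact mul_ne_zero (ofReal_ne_zero.2 hβ1.ne')
          (shear_ne_zero (div_pos hα1 hβ1).ne' (h.ne_zero k))
      have t : Filter.Tendsto
          (fun s => ∑ k, (ω k : ℂ) * dir (_root_.shear (b s) (ε s) (w s k))) 𝒰
          (𝓝 (∑ k, (ω k : ℂ) * dir (z₀ k))) :=
        tendsto_finsetSum _ fun k _ => (hdir k (hz k)).const_mul _
      have := tendsto_nhds_unique t (tendsto_const_nhds.congr' (hbal.mono fun s hs => hs.symm))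
      rw [← this]
      refine Finset.sum_congr rfl fun k _ => ?_
      rw [hzs, dir_real_smul hβ1.ne']

theorem IsStable.balanced_unique {ω : κ → ℝ} (hω : ∀ k, 0 < ω k) {o : κ} {w : κ → ℂ}
    (h : IsStable ω o w) {b ε b' ε' : ℝ} (hε : 0 < ε) (hε' : 0 < ε')
    (h1 : ∑ k, (ω k : ℂ) * dir (_root_.shear b ε (w k)) = 0)
    (h2 : ∑ k, (ω k : ℂ) * dir (_root_.shear b' ε' (w k)) = 0) : b' = b ∧ ε' = ε := by
  have key := (h.shear b hε.ne').eq_zero_and_eq_one hω (b := (b' - b) / ε) (div_pos hε' hε) h1 <| by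
    rw [← h2]
    refine Finset.sum_congr rfl fun k _ => ?_
    rw [shear_shear]
    congr 3 <;> field_simp
    ring
  obtain ⟨k1, k2⟩ := key
  rw [div_eq_one_iff_eq hε.ne'] at k2
  rw [div_eq_zero_iff, or_iff_left hε.ne', sub_eq_zero] at k1
  exact ⟨k1, k2⟩

/-- Stable families are balanced by shears depending continuously on the family. -/
theorem exists_continuousOn_balanced {ω : κ → ℝ} (hω : ∀ k, 0 < ω k) (o : κ) :
    ∃ b ε : (κ → ℂ) → ℝ, ContinuousOn b {w | IsStable ω o w} ∧
      ContinuousOn ε {w | IsStable ω o w} ∧ ∀ w, IsStable ω o w →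
        0 < ε w ∧ ∑ k, (ω k : ℂ) * dir (shear (b w) (ε w) (w k)) = 0 := by
  classical
  have hex : ∀ w : κ → ℂ, ∃ v : ℝ × ℝ, IsStable ω o w →
      0 < v.2 ∧ ∑ k, (ω k : ℂ) * dir (shear v.1 v.2 (w k)) = 0 := by
    intro w
    by_cases h : IsStable ω o w
    · obtain ⟨b, ε, hb⟩ := h.exists_balanced hω
      exact ⟨(b, ε), fun _ => hb⟩
    · exact ⟨0, fun h' => (h h').elim⟩
  choose v hv using hex
  have key : ∀ w, IsStable ω o w → ∀ 𝒰 : Ultrafilter (κ → ℂ), ↑𝒰 ≤ 𝓝[{w | IsStable ω o w}] w →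
      Filter.Tendsto (fun w => (v w).1) 𝒰 (𝓝 (v w).1) ∧
      Filter.Tendsto (fun w => (v w).2) 𝒰 (𝓝 (v w).2) := by
    intro w hw 𝒰 h𝒰
    have hst : ∀ᶠ w' in (𝒰 : Filter (κ → ℂ)), IsStable ω o w' := h𝒰 self_mem_nhdsWithin
    obtain ⟨b₀, ε₀, hε₀, hb, hε, hbal⟩ := hw.exists_tendsto hω 𝒰 (w := id)
      (b := fun w => (v w).1) (ε := fun w => (v w).2) (h𝒰.trans nhdsWithin_le_nhds)
      (hst.mono fun w' h' => (hv w' h').1) (hst.mono fun w' h' => (hv w' h').2)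
    obtain ⟨rfl, rfl⟩ := hw.balanced_unique hω (hv w hw).1 hε₀ (hv w hw).2 hbal
    exact ⟨hb, hε⟩
  exact ⟨fun w => (v w).1, fun w => (v w).2,
    fun w hw => (Filter.tendsto_iff_ultrafilter _ _ _).2 fun 𝒰 h => (key w hw 𝒰 h).1,
    fun w hw => (Filter.tendsto_iff_ultrafilter _ _ _).2 fun 𝒰 h => (key w hw 𝒰 h).2, hv⟩

end ConformalBarycenter

section ThreadSpace

open Set Topology

theorem IsSimplyConnected.of_retract {X Y : Type*} [TopologicalSpace X] [TopologicalSpace Y]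
    {s : Set X} {t : Set Y} (ht : IsSimplyConnected t) {f : X → Y} {g : Y → X}
    (hf : ContinuousOn f s) (hg : ContinuousOn g t) (hfs : MapsTo f s t) (hgt : MapsTo g t s)
    (h : ∀ x ∈ s, g (f x) = x) : IsSimplyConnected s := by
  have := ht.simplyConnectedSpace
  let F : C(s, t) := ⟨hfs.restrict, hf.mapsToRestrict hfs⟩
  let G : C(t, s) := ⟨hgt.restrict, hg.mapsToRestrict hgt⟩
  have hGF : G.comp F = ContinuousMap.id s := by
    ext x
    exact h x x.2
  refine simply_connected_iff_loops_nullhomotopic.2 ⟨?_, fun x γ => ?_⟩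
  · refine isPathConnected_iff_pathConnectedSpace.1 ?_
    have : s = g '' t := Subset.antisymm (fun x hx => ⟨f x, hfs hx, h x hx⟩) hgt.image_subset
    rw [this]
    exact ht.isPathConnected.image' hg
  · have key : ∀ H : C(s, s), H = ContinuousMap.id s →
        Path.Homotopic (γ.map H.continuous) (Path.refl (H x)) →
        Path.Homotopic γ (Path.refl x) := by
      rintro _ rfl h
      simpa using h
    refine key _ hGF ?_
    exact (SimplyConnectedSpace.paths_homotopic (γ.map F.continuous) (Path.refl (F x))).map G

/-- The configurations of a thread of `n` unit segments with endpoints at distance `l`. -/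
abbrev ThreadSpace (n : ℕ) (l : ℝ) : Type :=
  {u : Fin n → ℂ // (∀ i, ‖u i‖ = 1) ∧ ∑ i, u i = (l : ℂ)}

/-- The directions of a balanced family together with `i`, where `i` has weight `l`. -/
def IsStableThread (n : ℕ) (l : ℝ) (v : Fin n → ℂ) : Prop :=
  IsStable (fun k : Option (Fin n) => k.elim l fun _ => 1) none (fun k => k.elim Complex.I v)

open Complex in
theorem sum_option_mul_dir {n : ℕ} (l : ℝ) (v : Fin n → ℂ) (b ε : ℝ) :
    ∑ k : Option (Fin n), ((k.elim l fun _ => 1 : ℝ) : ℂ) *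
      dir (shear b ε (k.elim I v)) = ∑ j, dir (shear b ε (v j)) - l := by
  have : dir (shear b ε I) = -1 := by
    have hI : shear b ε I = I := by simp [shear, Complex.ext_iff]
    rw [hI, dir, conj_I, div_neg, div_self I_ne_zero]
  rw [Fintype.sum_option]
  simp [this]
  ring

/-- Stable families can be moved into the configuration space of the thread by shears, continuously
and without moving the configurations themselves. -/
theorem exists_thread_retraction {n : ℕ} {l : ℝ} (hl : 0 < l) [Nonempty (ThreadSpace n l)] :
    ∃ ρ : (Fin n → ℂ) → ThreadSpace n l, ContinuousOn ρ {v | IsStableThread n l v} ∧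
      (∀ v, IsStableThread n l v → ∃ b ε : ℝ, 0 < ε ∧ ∀ j, (ρ v).1 j = dir (shear b ε (v j))) ∧
      ∀ v, IsStableThread n l v → ∀ u : ThreadSpace n l, (∀ j, u.1 j = dir (v j)) → ρ v = u := by
  classical
  let e : (Fin n → ℂ) → Option (Fin n) → ℂ := fun v k => k.elim Complex.I v
  have he : Continuous e := continuous_pi fun k => by
    cases k with
    | none => exact continuous_const
    | some j => exact continuous_apply j
  have hω : ∀ k : Option (Fin n), 0 < (k.elim l fun _ => 1 : ℝ) := by
    rintro (_ | j)
    · exact hl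
    · exact one_pos
  obtain ⟨b, ε, hb, hε, h⟩ := exists_continuousOn_balanced hω none
  have hmem : ∀ v, IsStableThread n l v →
      (∀ j, ‖dir (shear (b (e v)) (ε (e v)) (v j))‖ = 1) ∧
        ∑ j, dir (shear (b (e v)) (ε (e v)) (v j)) = (l : ℂ) := by
    intro v hv
    obtain ⟨h1, h2⟩ := h _ hv
    refine ⟨fun j => norm_dir (shear_ne_zero h1.ne' (hv.ne_zero (some j))), ?_⟩
    rw [sum_option_mul_dir] at h2
    exact sub_eq_zero.1 h2
  let ρ : (Fin n → ℂ) → ThreadSpace n l := fun v =>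
    if hv : IsStableThread n l v then ⟨_, hmem v hv⟩ else Classical.arbitrary _
  have hρ : ∀ v, IsStableThread n l v → ∀ j,
      (ρ v).1 j = dir (shear (b (e v)) (ε (e v)) (v j)) := by
    intro v hv j
    simp [ρ, hv]
  refine ⟨ρ, ?_, fun v hv => ⟨_, _, (h _ hv).1, hρ v hv⟩, fun v hv u hu => ?_⟩
  · refine Topology.IsInducing.subtypeVal.continuousOn_iff.2 (continuousOn_pi.2 fun j => ?_)
    have hb' : ContinuousOn (fun v => b (e v)) {v | IsStableThread n l v} :=
      hb.comp he.continuousOn fun v hv => hv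
    have hε' : ContinuousOn (fun v => ε (e v)) {v | IsStableThread n l v} :=
      hε.comp he.continuousOn fun v hv => hv
    have hs : ContinuousOn (fun v => shear (b (e v)) (ε (e v)) (v j))
        {v | IsStableThread n l v} := by
      have : ∀ v : Fin n → ℂ, shear (b (e v)) (ε (e v)) (v j) =
          ((ε (e v) * (v j).re : ℝ) : ℂ) + ((v j).im - b (e v) * (v j).re : ℝ) * Complex.I := by
        intro v
        simp [shear, Complex.ext_iff]
      have hre : ContinuousOn (fun v : Fin n → ℂ => (v j).re) {v | IsStableThread n l v} := by
        fun_prop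
      have him : ContinuousOn (fun v : Fin n → ℂ => (v j).im) {v | IsStableThread n l v} := by
        fun_prop
      simp only [this]
      exact (Complex.continuous_ofReal.comp_continuousOn (hε'.mul hre)).add
        ((Complex.continuous_ofReal.comp_continuousOn (him.sub (hb'.mul hre))).mul
          continuousOn_const)
    refine ContinuousOn.congr (f := fun v => dir (shear (b (e v)) (ε (e v)) (v j))) ?_
      fun v hv => hρ v hv j
    intro v hv
    have hz : shear (b (e v)) (ε (e v)) (v j) ≠ 0 :=
      shear_ne_zero (h _ hv).1.ne' (hv.ne_zero (some j))
    exact ContinuousAt.comp_continuousWithinAt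
      (f := fun v => shear (b (e v)) (ε (e v)) (v j)) (continuousAt_dir hz) (hs v hv)
  · have h0 : ∑ k : Option (Fin n), ((k.elim l fun _ => 1 : ℝ) : ℂ) * dir (e v k) = 0 := by
      have := sum_option_mul_dir l v 0 1
      simp only [shear_zero_one] at this
      rw [this, ← Finset.sum_congr rfl fun j _ => hu j, u.2.2, sub_self]
    obtain ⟨h1, h2⟩ := hv.eq_zero_and_eq_one hω (h _ hv).1 h0 (h _ hv).2
    refine Subtype.ext (funext fun j => ?_)
    rw [hρ v hv, hu, h1, h2, shear_zero_one]

theorem isStableThread_of_card_le {n : ℕ} {l : ℝ} (hl1 : (n : ℝ) - 4 < l)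
    (hl2 : l < (n : ℝ) - 2) {v : Fin n → ℂ} (hv : ∀ j, v j ≠ 0)
    (h0 : ∀ j k, (v j).re = 0 → (v k).re = 0 → j = k)
    (h1 : ∀ K : Finset (Fin n),
      (∀ j ∈ K, ∀ k ∈ K, (v j).re * (v k).im = (v k).re * (v j).im) → K.card + 2 ≤ n) :
    IsStableThread n l v := by
  classical
  refine ⟨rfl, ?_, fun J hJ => ?_⟩
  · rintro (_ | j)
    · exact Complex.I_ne_zero
    · exact hv j
  have htot : ∑ k : Option (Fin n), (k.elim l fun _ => 1 : ℝ) = l + n := by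
    simp [Fintype.sum_option]
  rw [htot]
  have hpar : ∀ j ∈ J.eraseNone, ∀ k ∈ J.eraseNone,
      (v j).re * (v k).im = (v k).re * (v j).im := fun j hj k hk =>
    hJ _ (Finset.mem_eraseNone.1 hj) _ (Finset.mem_eraseNone.1 hk)
  by_cases hn : none ∈ J
  · have hsum : ∑ k ∈ J, (k.elim l fun _ => 1 : ℝ) = l + J.eraseNone.card := by
      have hJn : J = Finset.insertNone J.eraseNone := by
        rw [Finset.insertNone_eraseNone, Finset.insert_eq_of_mem hn]
      conv_lhs => rw [hJn, Finset.sum_insertNone]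
      simp
    have hre : ∀ j ∈ J.eraseNone, (v j).re = 0 := fun j hj => by
      simpa using (hJ _ hn _ (Finset.mem_eraseNone.1 hj)).symm
    have hc : (J.eraseNone.card : ℝ) ≤ 1 := by
      exact_mod_cast Finset.card_le_one.2 fun j hj k hk => h0 j k (hre j hj) (hre k hk)
    rw [hsum]
    linarith
  · have hsum : ∑ k ∈ J, (k.elim l fun _ => 1 : ℝ) = J.eraseNone.card := by
      conv_lhs => rw [← Finset.erase_eq_of_notMem hn, ← Finset.map_some_eraseNone, Finset.sum_map]
      simp
    have hc : (J.eraseNone.card : ℝ) + 2 ≤ n := by exact_mod_cast h1 _ hpar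
    rw [hsum]
    linarith

/-- The half-angle tangent of a point of the unit circle. -/
noncomputable def halfSlope (z : ℂ) : ℝ := z.im / (1 + z.re)

theorem continuousAt_halfSlope {z : ℂ} (hz : 1 + z.re ≠ 0) : ContinuousAt halfSlope z := by
  unfold halfSlope
  fun_prop (disch := assumption)

theorem one_add_re_ne_zero {z : ℂ} (hz : ‖z‖ = 1) (h : z ≠ -1) : 1 + z.re ≠ 0 := by
  intro h0
  have h1 : z.re = -1 := by linarith
  have h2 : z.re * z.re + z.im * z.im = 1 := by
    rw [← Complex.normSq_apply, Complex.normSq_eq_norm_sq, hz, one_pow]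
  have h3 : z.im = 0 := by
    rw [h1] at h2
    nlinarith
  exact h (Complex.ext (by simpa using h1) (by simpa using h3))

theorem dir_ne_neg_one {z : ℂ} (hz : z.re ≠ 0) : dir z ≠ -1 := by
  intro h
  have h1 := congrArg Complex.re h
  have h2 : 0 < Complex.normSq z := Complex.normSq_pos.2 fun h => hz (by simp [h])
  rw [dir_re, div_eq_iff h2.ne', Complex.normSq_apply] at h1
  simp only [Complex.neg_re, Complex.one_re] at h1
  have : 0 < z.re ^ 2 := by positivity
  nlinarith

theorem halfSlope_dir {z : ℂ} (hz : z.re ≠ 0) : halfSlope (dir z) = z.im / z.re := by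
  have h2 : 0 < Complex.normSq z := Complex.normSq_pos.2 fun h => hz (by simp [h])
  have h3 : 1 + (z.re ^ 2 - z.im ^ 2) / Complex.normSq z = 2 * z.re ^ 2 / Complex.normSq z := by
    rw [eq_div_iff h2.ne', add_mul, div_mul_cancel₀ _ h2.ne', Complex.normSq_apply]
    ring
  rw [halfSlope, dir_re, dir_im, h3]
  field_simp

theorem dir_eq_of_mul_conj {z u : ℂ} (hz : z ≠ 0) (h : z = u * (starRingEnd ℂ) z) : dir z = u := by
  rw [dir, div_eq_iff (by simpa using hz)]
  exact h

theorem re_mul_re_add_im_mul_im {z : ℂ} (hz : ‖z‖ = 1) : z.re * z.re + z.im * z.im = 1 := by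
  rw [← Complex.normSq_apply, Complex.normSq_eq_norm_sq, hz, one_pow]

theorem dir_halfSlope {u : ℂ} (hu : ‖u‖ = 1) (h : u ≠ -1) : dir ⟨1, halfSlope u⟩ = u := by
  have h0 := one_add_re_ne_zero hu h
  have h1 := re_mul_re_add_im_mul_im hu
  refine dir_eq_of_mul_conj (fun h => one_ne_zero (congrArg Complex.re h)) (Complex.ext ?_ ?_)
  · simp only [halfSlope, Complex.mul_re, Complex.conj_re, Complex.conj_im]
    field_simp
    linear_combination -h1
  · simp only [halfSlope, Complex.mul_im, Complex.conj_re, Complex.conj_im]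
    field_simp
    ring

/-- Half-angle numerator of the angle between `u` and the direction of slope `y`. -/
def crossNum (y : ℝ) (u : ℂ) : ℝ := u.im - y * (1 + u.re)

/-- Half-angle denominator of the angle between `u` and the direction of slope `y`. -/
def crossDen (y : ℝ) (u : ℂ) : ℝ := (1 - u.re) - 2 * y * u.im + y ^ 2 * (1 + u.re)

theorem crossDen_mul {u : ℂ} (hu : ‖u‖ = 1) (y : ℝ) :
    crossDen y u * (1 + u.re) = crossNum y u ^ 2 := by
  have h1 := re_mul_re_add_im_mul_im hu
  simp only [crossDen, crossNum]
  linear_combination -h1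

theorem crossNum_dir (y : ℝ) {z : ℂ} (hz : z ≠ 0) :
    crossNum y (dir z) = 2 * z.re * (z.im - y * z.re) / Complex.normSq z := by
  have h2 : 0 < Complex.normSq z := Complex.normSq_pos.2 hz
  rw [crossNum, dir_re, dir_im, eq_div_iff h2.ne']
  field_simp
  rw [Complex.normSq_apply]
  ring

theorem crossDen_dir (y : ℝ) {z : ℂ} (hz : z ≠ 0) :
    crossDen y (dir z) = 2 * (z.im - y * z.re) ^ 2 / Complex.normSq z := by
  have h2 : 0 < Complex.normSq z := Complex.normSq_pos.2 hz
  rw [crossDen, dir_re, dir_im, eq_div_iff h2.ne']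
  field_simp
  rw [Complex.normSq_apply]
  ring

theorem dir_cross {u : ℂ} (hu : ‖u‖ = 1) {y r : ℝ} (hr : 0 < r) (hD : 0 < crossDen y u) :
    dir ⟨r * crossNum y u / crossDen y u, r * crossNum y u / crossDen y u * y + r⟩ = u := by
  have h1 := re_mul_re_add_im_mul_im hu
  have hz : (⟨r * crossNum y u / crossDen y u, r * crossNum y u / crossDen y u * y + r⟩ : ℂ) =
      ((r / crossDen y u : ℝ) : ℂ) * ⟨crossNum y u, (1 - u.re) - y * u.im⟩ := by
    apply Complex.ext
    · simp only [Complex.re_ofReal_mul]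
      ring
    · simp only [Complex.im_ofReal_mul]
      field_simp
      simp only [crossNum, crossDen]
      ring
  rw [hz, dir_real_smul (div_pos hr hD).ne']
  refine dir_eq_of_mul_conj (fun h => ?_) (Complex.ext ?_ ?_)
  · have h2 : crossNum y u = 0 := congrArg Complex.re h
    have h3 : (1 - u.re) - y * u.im = 0 := congrArg Complex.im h
    refine hD.ne' ?_
    simp only [crossNum, crossDen] at h2 ⊢
    linear_combination h3 - y * h2
  · simp only [crossNum, Complex.mul_re, Complex.conj_re, Complex.conj_im]
    linear_combination y * h1
  · simp only [crossNum, Complex.mul_im, Complex.conj_re, Complex.conj_im]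
    linear_combination -h1

end ThreadSpace

section ThreadCharts

open Set Topology

variable {n : ℕ}

/-- The vectors whose coordinates other than the `i`-th one coincide. -/
def constAwayFrom (i : Fin n) : Submodule ℝ (Fin n → ℝ) where
  carrier := {x | ∀ j, j ≠ i → ∀ k, k ≠ i → x j = x k}
  zero_mem' _ _ _ _ := rfl
  add_mem' hx hy j hj k hk := congrArg₂ (· + ·) (hx j hj k hk) (hy j hj k hk)
  smul_mem' c _ hx j hj k hk := congrArg (c * ·) (hx j hj k hk)

theorem finrank_constAwayFrom_le [Nontrivial (Fin n)] (i : Fin n) :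
    Module.finrank ℝ (constAwayFrom i) ≤ 2 := by
  obtain ⟨j, hj⟩ := exists_ne i
  let f : (Fin n → ℝ) →ₗ[ℝ] ℝ × ℝ := (LinearMap.proj i).prod (LinearMap.proj j)
  have hf : Function.Injective (f.comp (constAwayFrom i).subtype) := by
    rw [← LinearMap.ker_eq_bot, LinearMap.ker_eq_bot']
    rintro ⟨x, hx⟩ h
    have hi : x i = 0 := congrArg Prod.fst h
    have hj0 : x j = 0 := congrArg Prod.snd h
    refine Subtype.ext (funext fun k => ?_)
    by_cases hk : k = i
    · rw [hk]
      exact hi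
    · exact (hx k hk j hj).trans hj0
  simpa using LinearMap.finrank_le_finrank_of_injective hf

/-- The total distance of the coordinates other than the `i`-th one from the `j`-th one. -/
def spread (i j : Fin n) (x : Fin n → ℝ) : ℝ := ∑ k ∈ Finset.univ.erase i, |x k - x j|

theorem abs_sub_le_spread {i k : Fin n} (j : Fin n) (hk : k ≠ i) (x : Fin n → ℝ) :
    |x k - x j| ≤ spread i j x :=
  Finset.single_le_sum (f := fun k => |x k - x j|) (fun _ _ => abs_nonneg _)
    (Finset.mem_erase.2 ⟨hk, Finset.mem_univ k⟩)

theorem spread_pos {i j : Fin n} {x : Fin n → ℝ} (hx : x ∉ constAwayFrom i) :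
    0 < spread i j x := by
  refine (Finset.sum_nonneg fun _ _ => abs_nonneg _).lt_of_ne fun h => hx fun k hk m hm => ?_
  have h0 : ∀ k, k ≠ i → x k = x j := fun k hk => by
    have := abs_sub_le_spread j hk x
    rw [spread, ← h] at this
    exact sub_eq_zero.1 (abs_nonpos_iff.1 this)
  rw [h0 k hk, h0 m hm]

theorem spread_congr {i j : Fin n} (hj : j ≠ i) {x y : Fin n → ℝ} (c r : ℝ)
    (h : ∀ k, k ≠ i → y k = (x k - c) / r) (hr : 0 < r) : spread i j y = spread i j x / r := by
  rw [spread, spread, Finset.sum_div]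
  refine Finset.sum_congr rfl fun k hk => ?_
  rw [h k (Finset.ne_of_mem_erase hk), h j hj, ← sub_div, sub_sub_sub_cancel_right, abs_div,
    abs_of_pos hr]

theorem card_add_two_le_of_notMem {i : Fin n} {x : Fin n → ℝ} (hx : x ∉ constAwayFrom i)
    {K : Finset (Fin n)} (hi : i ∉ K) (hK : ∀ j ∈ K, ∀ k ∈ K, x j = x k) : K.card + 2 ≤ n := by
  by_contra! h
  refine hx fun j hj k hk => ?_
  have hsub : K ⊆ Finset.univ.erase i := fun j hj =>
    Finset.mem_erase.2 ⟨fun h => hi (h ▸ hj), Finset.mem_univ j⟩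
  have hcard : (Finset.univ.erase i : Finset (Fin n)).card ≤ K.card := by
    rw [Finset.card_erase_of_mem (Finset.mem_univ i), Finset.card_univ, Fintype.card_fin]
    omega
  have heq := Finset.eq_of_subset_of_card_le hsub hcard
  exact hK j (heq ▸ Finset.mem_erase.2 ⟨hj, Finset.mem_univ j⟩)
    k (heq ▸ Finset.mem_erase.2 ⟨hk, Finset.mem_univ k⟩)

theorem isStableThread_one {l : ℝ} (hn : 0 < n) (hl1 : (n : ℝ) - 4 < l) (hl2 : l < (n : ℝ) - 2)
    {x : Fin n → ℝ} (hx : ∀ i, x ∉ constAwayFrom i) :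
    IsStableThread n l fun j => ⟨1, x j⟩ := by
  refine isStableThread_of_card_le hl1 hl2 (fun j h => one_ne_zero (congrArg Complex.re h))
    (fun j k h => (one_ne_zero h).elim) fun K hK => ?_
  have hK' : ∀ j ∈ K, ∀ k ∈ K, x j = x k := fun j hj k hk => by simpa using (hK j hj k hk).symm
  by_cases h : ∃ i, i ∉ K
  · obtain ⟨i, hi⟩ := h
    exact card_add_two_le_of_notMem (hx i) hi hK'
  · push Not at h
    exact (hx ⟨0, hn⟩ fun j _ k _ => hK' j (h j) k (h k)).elim

/-- Vectors with slopes `x j`, except for the `i`-th one, whose first coordinate is `x i` and which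
avoids the directions of the other ones as long as `|x i| < 1`. -/
def bent (i j : Fin n) (x : Fin n → ℝ) (k : Fin n) : ℂ :=
  if k = i then ⟨x i, x i * x j + 3 * spread i j x⟩ else ⟨1, x k⟩

theorem bent_self (i j : Fin n) (x : Fin n → ℝ) :
    bent i j x i = ⟨x i, x i * x j + 3 * spread i j x⟩ := if_pos rfl

theorem bent_of_ne {i k : Fin n} (hk : k ≠ i) (j : Fin n) (x : Fin n → ℝ) :
    bent i j x k = ⟨1, x k⟩ := if_neg hk

theorem bent_ne_zero {i : Fin n} (j : Fin n) {x : Fin n → ℝ} (hx : x ∉ constAwayFrom i)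
    (k : Fin n) : bent i j x k ≠ 0 := by
  intro h
  by_cases hk : k = i
  · rw [hk, bent_self] at h
    have h1 : x i = 0 := congrArg Complex.re h
    have h2 : x i * x j + 3 * spread i j x = 0 := congrArg Complex.im h
    have := spread_pos (j := j) hx
    rw [h1] at h2
    linarith
  · rw [bent_of_ne hk] at h
    exact one_ne_zero (congrArg Complex.re h)

theorem isStableThread_bent {l : ℝ} (hn : 3 ≤ n) (hl1 : (n : ℝ) - 4 < l) (hl2 : l < (n : ℝ) - 2)
    {i : Fin n} (j : Fin n) {x : Fin n → ℝ} (hx : x ∉ constAwayFrom i) (hxi : |x i| < 1) :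
    IsStableThread n l (bent i j x) := by
  have hre : ∀ k, (bent i j x k).re = 0 → k = i := fun k hk => by
    by_contra h
    rw [bent_of_ne h] at hk
    exact one_ne_zero hk
  refine isStableThread_of_card_le hl1 hl2 (bent_ne_zero j hx)
    (fun k m hk hm => (hre k hk).trans (hre m hm).symm) fun K hK => ?_
  have hne : ∀ k ∈ K, k ≠ i → i ∉ K := fun k hk hki hi => by
    have h := hK k hk i hi
    rw [bent_self, bent_of_ne hki] at h
    simp only at h
    have h1 : 3 * spread i j x = x i * (x k - x j) := by linarith
    have h2 := abs_sub_le_spread j hki x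
    have h3 := spread_pos (j := j) hx
    have h4 : |3 * spread i j x| ≤ 1 * spread i j x := by
      rw [h1, abs_mul]
      exact mul_le_mul hxi.le h2 (abs_nonneg _) zero_le_one
    rw [abs_of_pos (by linarith)] at h4
    linarith
  by_cases hi : i ∈ K
  · have : K.card ≤ 1 := Finset.card_le_one.2 fun k hk m hm => by
      have h1 : k = i := by
        by_contra h
        exact hne k hk h hi
      have h2 : m = i := by
        by_contra h
        exact hne m hm h hi
      rw [h1, h2]
    omega
  · refine card_add_two_le_of_notMem hx hi fun k hk m hm => ?_
    have h := hK k hk m hm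
    rw [bent_of_ne (ne_of_mem_of_not_mem hk hi), bent_of_ne (ne_of_mem_of_not_mem hm hi)] at h
    simpa using h.symm

end ThreadCharts

section ThreadRegions

open Set Topology

variable {n : ℕ} {l : ℝ}

/-- The half-angle tangents of all segments of a thread. -/
noncomputable def threadSlope (u : Fin n → ℂ) (k : Fin n) : ℝ := halfSlope (u k)

theorem threadSlope_notMem_constAwayFrom [Nontrivial (Fin n)] (hl0 : 0 < l)
    (hl2 : l < (n : ℝ) - 2) (u : ThreadSpace n l) {i : Fin n} (hu : ∀ k, k ≠ i → u.1 k ≠ -1) :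
    threadSlope u.1 ∉ constAwayFrom i := by
  intro h
  obtain ⟨j, hj⟩ := exists_ne i
  have hc : ∀ k ∈ Finset.univ.erase i, u.1 k = u.1 j := fun k hk => by
    have hk := Finset.ne_of_mem_erase hk
    rw [← dir_halfSlope (u.2.1 k) (hu k hk), ← dir_halfSlope (u.2.1 j) (hu j hj)]
    exact congrArg (fun t => dir ⟨1, t⟩) (h k hk j hj)
  have hn : 1 ≤ n := i.pos
  have hsum : ((n : ℂ) - 1) * u.1 j = l - u.1 i := by
    have h0 := u.2.2
    rw [← Finset.add_sum_erase _ _ (Finset.mem_univ i), Finset.sum_congr rfl hc,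
      Finset.sum_const, Finset.card_erase_of_mem (Finset.mem_univ i), Finset.card_univ,
      Fintype.card_fin, nsmul_eq_mul, Nat.cast_sub hn] at h0
    push_cast at h0
    linear_combination h0
  have hnorm := congrArg norm hsum
  have h1 : ((n : ℂ) - 1) = ((n - 1 : ℝ) : ℂ) := by push_cast; ring
  have h2 : (1 : ℝ) ≤ n := by exact_mod_cast hn
  rw [h1, norm_mul, Complex.norm_real, Real.norm_of_nonneg (by linarith), u.2.1 j, mul_one] at hnorm
  have h3 := norm_sub_le (l : ℂ) (u.1 i)
  rw [Complex.norm_real, Real.norm_of_nonneg hl0.le, u.2.1 i] at h3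
  linarith

/-- The signed position of the `i`-th segment relative to the slopes of the other ones. -/
noncomputable def bentPos (i j : Fin n) (u : Fin n → ℂ) : ℝ :=
  3 * spread i j (threadSlope u) * crossNum (threadSlope u j) (u i) /
    crossDen (threadSlope u j) (u i)

/-- The threads none of whose segments points backwards. -/
def forwardRegion (n : ℕ) (l : ℝ) : Set (ThreadSpace n l) := {u | ∀ k, u.1 k ≠ -1}

/-- The threads whose `i`-th segment has its relative position in `s`, while no other segment
points backwards. -/
def bentRegion (l : ℝ) (i j : Fin n) (s : Set ℝ) : Set (ThreadSpace n l) :=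
  {u | (∀ k, k ≠ i → u.1 k ≠ -1) ∧ 0 < crossDen (threadSlope u.1 j) (u.1 i) ∧
    bentPos i j u.1 ∈ s}

theorem continuous_segment (k : Fin n) : Continuous fun u : ThreadSpace n l => u.1 k :=
  (continuous_apply k).comp continuous_subtype_val

theorem continuousAt_threadSlope {u : ThreadSpace n l} {k : Fin n} (h : u.1 k ≠ -1) :
    ContinuousAt (fun u : ThreadSpace n l => threadSlope u.1 k) u :=
  ContinuousAt.comp (f := fun u : ThreadSpace n l => u.1 k)
    (continuousAt_halfSlope (one_add_re_ne_zero (u.2.1 k) h)) (continuous_segment k).continuousAt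

theorem continuousAt_crossDen {i j : Fin n} {u : ThreadSpace n l} (h : u.1 j ≠ -1) :
    ContinuousAt (fun u : ThreadSpace n l => crossDen (threadSlope u.1 j) (u.1 i)) u := by
  have h1 := continuousAt_threadSlope h
  have hre := (Complex.continuous_re.comp (continuous_segment (l := l) i)).continuousAt (x := u)
  have him := (Complex.continuous_im.comp (continuous_segment (l := l) i)).continuousAt (x := u)
  exact ((continuousAt_const.sub hre).sub ((continuousAt_const.mul h1).mul him)).add
    ((h1.pow 2).mul (continuousAt_const.add hre))

theorem continuousAt_bentPos {i j : Fin n} (hj : j ≠ i) {u : ThreadSpace n l}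
    (hu : ∀ k, k ≠ i → u.1 k ≠ -1) (hD : 0 < crossDen (threadSlope u.1 j) (u.1 i)) :
    ContinuousAt (fun u : ThreadSpace n l => bentPos i j u.1) u := by
  have h1 : ∀ k, k ≠ i → ContinuousAt (fun u : ThreadSpace n l => threadSlope u.1 k) u :=
    fun k hk => continuousAt_threadSlope (hu k hk)
  have h2 : ContinuousAt (fun u : ThreadSpace n l => spread i j (threadSlope u.1)) u := by
    unfold spread
    exact tendsto_finsetSum _ fun k hk =>
      ((h1 k (Finset.ne_of_mem_erase hk)).sub (h1 j hj)).abs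
  have h3 : ContinuousAt
      (fun u : ThreadSpace n l => crossNum (threadSlope u.1 j) (u.1 i)) u := by
    have hre := (Complex.continuous_re.comp (continuous_segment (l := l) i)).continuousAt (x := u)
    have him := (Complex.continuous_im.comp (continuous_segment (l := l) i)).continuousAt (x := u)
    exact him.sub ((h1 j hj).mul (continuousAt_const.add hre))
  exact ((continuousAt_const.mul h2).mul h3).div (continuousAt_crossDen (hu j hj)) hD.ne'

theorem isOpen_forwardRegion : IsOpen (forwardRegion n l) := by
  have : forwardRegion n l = ⋂ k, {u | u.1 k ≠ -1} := by
    ext u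
    simp [forwardRegion]
  rw [this]
  exact isOpen_iInter_of_finite fun k => isOpen_ne_fun (continuous_segment k) continuous_const

theorem isOpen_bentRegion {i j : Fin n} (hj : j ≠ i) {s : Set ℝ} (hs : IsOpen s) :
    IsOpen (bentRegion l i j s) := by
  have hA : IsOpen {u : ThreadSpace n l | ∀ k, k ≠ i → u.1 k ≠ -1} := by
    have : {u : ThreadSpace n l | ∀ k, k ≠ i → u.1 k ≠ -1} =
        ⋂ k, ⋂ _ : k ≠ i, {u | u.1 k ≠ -1} := by
      ext u
      simp
    rw [this]
    exact isOpen_iInter_of_finite fun k => isOpen_iInter_of_finite fun _ =>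
      isOpen_ne_fun (continuous_segment k) continuous_const
  have hB : IsOpen {u : ThreadSpace n l | (∀ k, k ≠ i → u.1 k ≠ -1) ∧
      0 < crossDen (threadSlope u.1 j) (u.1 i)} :=
    ContinuousOn.isOpen_inter_preimage
      (f := fun u : ThreadSpace n l => crossDen (threadSlope u.1 j) (u.1 i))
      (fun u hu => (continuousAt_crossDen (hu j hj)).continuousWithinAt) hA isOpen_Ioi
  have := ContinuousOn.isOpen_inter_preimage (f := fun u : ThreadSpace n l => bentPos i j u.1)
    (fun u hu => (continuousAt_bentPos hj hu.1 hu.2).continuousWithinAt) hB hs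
  convert this using 1
  ext u
  exact and_assoc.symm

theorem continuous_complex_mk {X : Type*} [TopologicalSpace X] {f g : X → ℝ} (hf : Continuous f)
    (hg : Continuous g) : Continuous fun x => (⟨f x, g x⟩ : ℂ) := by
  simp only [Complex.mk_eq_add_mul_I]
  fun_prop

theorem isSimplyConnected_forwardRegion [Nonempty (ThreadSpace n l)] (hn : 6 ≤ n)
    (hl1 : (n : ℝ) - 4 < l) (hl2 : l < (n : ℝ) - 2) : IsSimplyConnected (forwardRegion n l) := by
  have hn' : (6 : ℝ) ≤ n := by exact_mod_cast hn
  have hl0 : 0 < l := by linarith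
  have : Nontrivial (Fin n) := Fin.nontrivial_iff_two_le.2 (by omega)
  obtain ⟨ρ, hρc, hρ, hρu⟩ := exists_thread_retraction (n := n) hl0
  have hT : IsSimplyConnected (univ \ ⋃ i : Fin n, (constAwayFrom i : Set (Fin n → ℝ))) :=
    isSimplyConnected_diff_iUnion_submodule isOpen_univ convex_univ univ_nonempty _ fun i => by
      have := finrank_constAwayFrom_le i
      rw [Module.finrank_fin_fun]
      omega
  have hst : ∀ x ∈ univ \ ⋃ i : Fin n, (constAwayFrom i : Set (Fin n → ℝ)),
      IsStableThread n l fun j => ⟨1, x j⟩ := fun x hx =>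
    isStableThread_one (by omega) hl1 hl2 fun i hi => hx.2 (mem_iUnion.2 ⟨i, hi⟩)
  have hmaps : MapsTo (fun u : ThreadSpace n l => threadSlope u.1) (forwardRegion n l)
      (univ \ ⋃ i : Fin n, (constAwayFrom i : Set (Fin n → ℝ))) := fun u hu =>
    ⟨mem_univ _, fun h => by
      obtain ⟨i, hi⟩ := mem_iUnion.1 h
      exact threadSlope_notMem_constAwayFrom hl0 hl2 u (fun k _ => hu k) hi⟩
  refine hT.of_retract (f := fun u : ThreadSpace n l => threadSlope u.1)
    (g := fun x => ρ fun j => ⟨1, x j⟩) ?_ ?_ hmaps ?_ ?_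
  · exact fun u hu =>
      (continuousAt_pi.2 fun k => continuousAt_threadSlope (hu k)).continuousWithinAt
  · exact hρc.comp (continuous_pi fun j =>
      continuous_complex_mk continuous_const (continuous_apply j)).continuousOn hst
  · intro x hx k
    obtain ⟨b, ε, hε, h⟩ := hρ _ (hst x hx)
    rw [h]
    exact dir_ne_neg_one (by simp [shear, hε.ne'])
  · intro u hu
    exact hρu _ (hst _ (hmaps hu)) u fun j => (dir_halfSlope (u.2.1 j) (hu j)).symm

theorem bentPos_dir_shear {i j : Fin n} (hj : j ≠ i) {x : Fin n → ℝ} (hx : x ∉ constAwayFrom i)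
    {b ε : ℝ} (hε : 0 < ε) {u : Fin n → ℂ} (hu : ∀ k, u k = dir (shear b ε (bent i j x k))) :
    0 < crossDen (threadSlope u j) (u i) ∧ bentPos i j u = x i := by
  have hs : ∀ k, k ≠ i → threadSlope u k = (x k - b) / ε := fun k hk => by
    rw [threadSlope, hu, bent_of_ne hk, halfSlope_dir (by simpa [shear] using hε.ne')]
    simp [shear]
  have hσ := spread_pos (j := j) hx
  have hσ' := spread_congr hj b ε hs hε
  have hz : shear b ε (bent i j x i) ≠ 0 := shear_ne_zero hε.ne' (bent_ne_zero j hx i)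
  have hq := Complex.normSq_pos.2 hz
  have him : (shear b ε (bent i j x i)).im -
      threadSlope u j * (shear b ε (bent i j x i)).re = 3 * spread i j x := by
    rw [hs j hj, bent_self]
    simp only [shear]
    field_simp
    ring
  have hre : (shear b ε (bent i j x i)).re = ε * x i := by simp [bent_self, shear]
  have hD : crossDen (threadSlope u j) (u i) =
      2 * (3 * spread i j x) ^ 2 / Complex.normSq (shear b ε (bent i j x i)) := by
    rw [hu i, crossDen_dir _ hz, him]
  have hN : crossNum (threadSlope u j) (u i) =
      2 * (ε * x i) * (3 * spread i j x) / Complex.normSq (shear b ε (bent i j x i)) := by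
    rw [hu i, crossNum_dir _ hz, him, hre]
  refine ⟨by rw [hD]; positivity, ?_⟩
  rw [bentPos, hD, hN, hσ']
  field_simp

theorem isSimplyConnected_bentRegion [Nonempty (ThreadSpace n l)] (hn : 6 ≤ n)
    (hl1 : (n : ℝ) - 4 < l) (hl2 : l < (n : ℝ) - 2) {i j : Fin n} (hj : j ≠ i) {s : Set ℝ}
    (hso : IsOpen s) (hsc : Convex ℝ s) (hsn : s.Nonempty) (hs : s ⊆ Ioo (-1) 1) :
    IsSimplyConnected (bentRegion l i j s) := by
  have hn' : (6 : ℝ) ≤ n := by exact_mod_cast hn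
  have hl0 : 0 < l := by linarith
  have : Nontrivial (Fin n) := Fin.nontrivial_iff_two_le.2 (by omega)
  obtain ⟨ρ, hρc, hρ, hρu⟩ := exists_thread_retraction (n := n) hl0
  set T : Set (Fin n → ℝ) := (fun x : Fin n → ℝ => x i) ⁻¹' s \
    ⋃ _ : Unit, (constAwayFrom i : Set (Fin n → ℝ)) with hTdef
  have hT : IsSimplyConnected T := by
    refine isSimplyConnected_diff_iUnion_submodule (hso.preimage (continuous_apply i))
      (hsc.linear_preimage (LinearMap.proj i : (Fin n → ℝ) →ₗ[ℝ] ℝ)) ?_ _ fun _ => ?_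
    · obtain ⟨a, ha⟩ := hsn
      exact ⟨fun _ => a, ha⟩
    · have := finrank_constAwayFrom_le i
      rw [Module.finrank_fin_fun]
      omega
  have hTi : ∀ x ∈ T, x ∉ constAwayFrom i := fun x hx hi => hx.2 (mem_iUnion.2 ⟨(), hi⟩)
  have hst : ∀ x ∈ T, IsStableThread n l (bent i j x) := fun x hx =>
    isStableThread_bent (by omega) hl1 hl2 j (hTi x hx) (abs_lt.2 (hs hx.1))
  have hbent : Continuous (bent i j) := by
    refine continuous_pi fun k => ?_
    by_cases hk : k = i
    · subst hk
      simp only [bent_self]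
      unfold spread
      exact continuous_complex_mk (by fun_prop) (by fun_prop)
    · simp only [bent_of_ne hk]
      exact continuous_complex_mk continuous_const (continuous_apply k)
  have hmaps : MapsTo (fun u : ThreadSpace n l =>
      Function.update (threadSlope u.1) i (bentPos i j u.1)) (bentRegion l i j s) T := by
    refine fun u hu => ⟨?_, fun h => ?_⟩
    · simpa using hu.2.2
    · obtain ⟨_, h⟩ := mem_iUnion.1 h
      refine threadSlope_notMem_constAwayFrom hl0 hl2 u hu.1 fun k hk m hm => ?_
      have := h k hk m hm
      beta_reduce at this
      rwa [Function.update_of_ne hk, Function.update_of_ne hm] at this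
  refine hT.of_retract (f := fun u : ThreadSpace n l =>
      Function.update (threadSlope u.1) i (bentPos i j u.1))
    (g := fun x => ρ (bent i j x)) ?_ ?_ hmaps ?_ ?_
  · intro u hu
    refine (continuousAt_pi.2 fun k => ?_).continuousWithinAt
    by_cases hk : k = i
    · subst hk
      simpa only [Function.update_self] using continuousAt_bentPos hj hu.1 hu.2.1
    · simpa only [Function.update_of_ne hk] using continuousAt_threadSlope (hu.1 k hk)
  · exact hρc.comp hbent.continuousOn hst
  · intro x hx
    obtain ⟨b, ε, hε, h⟩ := hρ _ (hst x hx)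
    obtain ⟨hD, hp⟩ := bentPos_dir_shear hj (hTi x hx) hε h
    refine ⟨fun k hk => ?_, hD, ?_⟩
    · rw [h, bent_of_ne hk]
      exact dir_ne_neg_one (by simp [shear, hε.ne'])
    · rw [hp]
      exact hx.1
  · intro u hu
    refine hρu _ (hst _ (hmaps hu)) u fun k => ?_
    by_cases hk : k = i
    · have hσ := spread_pos (j := j) (threadSlope_notMem_constAwayFrom hl0 hl2 u hu.1)
      have hσ' : spread i j (Function.update (threadSlope u.1) i (bentPos i j u.1)) =
          spread i j (threadSlope u.1) := by
        rw [spread_congr hj 0 1 (fun k hk => ?_) one_pos, div_one]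
        rw [Function.update_of_ne hk, sub_zero, div_one]
      beta_reduce
      rw [hk, bent_self, hσ', Function.update_self, Function.update_of_ne hj, bentPos,
        dir_cross (u.2.1 i) (by positivity) hu.2.1]
    · beta_reduce
      rw [bent_of_ne hk, Function.update_of_ne hk]
      exact (dir_halfSlope (u.2.1 k) (hu.1 k hk)).symm

end ThreadRegions

section ThreadCover

open Set Topology

variable {n : ℕ} {l : ℝ}

theorem ThreadSpace.eq_of_eq_neg_one (hl1 : (n : ℝ) - 4 < l) (u : ThreadSpace n l) {i k : Fin n}
    (hi : u.1 i = -1) (hk : u.1 k = -1) : k = i := by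
  by_contra h
  have h0 := congrArg Complex.re u.2.2
  have hk' : k ∈ Finset.univ.erase i := Finset.mem_erase.2 ⟨h, Finset.mem_univ k⟩
  rw [← Finset.add_sum_erase _ _ (Finset.mem_univ i), ← Finset.add_sum_erase _ _ hk', hi, hk] at h0
  simp only [Complex.add_re, Complex.re_sum, Complex.neg_re, Complex.one_re,
    Complex.ofReal_re] at h0
  have h1 := Finset.sum_le_card_nsmul ((Finset.univ.erase i).erase k) (fun m => (u.1 m).re) 1
    fun m _ => (Complex.re_le_norm _).trans (u.2.1 m).le
  have hcard : ((Finset.univ.erase i).erase k).card + 2 = n := by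
    have h2 := Finset.card_erase_add_one hk'
    have h3 := Finset.card_erase_add_one (Finset.mem_univ i)
    rw [Finset.card_univ, Fintype.card_fin] at h3
    omega
  have hcard' : (((Finset.univ.erase i).erase k).card : ℝ) + 2 = n := by exact_mod_cast hcard
  rw [nsmul_one] at h1
  linarith

theorem bentPos_eq_zero_iff [Nontrivial (Fin n)] (hl0 : 0 < l) (hl2 : l < (n : ℝ) - 2)
    {u : ThreadSpace n l} {i j : Fin n} (hu : ∀ k, k ≠ i → u.1 k ≠ -1)
    (hD : 0 < crossDen (threadSlope u.1 j) (u.1 i)) : bentPos i j u.1 = 0 ↔ u.1 i = -1 := by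
  have hσ := spread_pos (j := j) (threadSlope_notMem_constAwayFrom hl0 hl2 u hu)
  have hmul := crossDen_mul (u.2.1 i) (threadSlope u.1 j)
  constructor
  · intro h
    by_contra hi
    have hN : crossNum (threadSlope u.1 j) (u.1 i) = 0 := by
      rw [bentPos, div_eq_zero_iff, mul_eq_zero] at h
      exact (h.resolve_right hD.ne').resolve_left (by positivity)
    rw [hN, zero_pow two_ne_zero] at hmul
    exact (mul_ne_zero hD.ne' (one_add_re_ne_zero (u.2.1 i) hi)) hmul
  · intro h
    simp [bentPos, crossNum, h]

theorem mem_bentRegion_of_eq_neg_one (hl1 : (n : ℝ) - 4 < l) {u : ThreadSpace n l} {i : Fin n}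
    (j : Fin n) (hi : u.1 i = -1) : u ∈ bentRegion l i j (Ioo (-1) 1) := by
  refine ⟨fun k hk h => hk (ThreadSpace.eq_of_eq_neg_one hl1 u hi h), ?_, ?_⟩
  · simp only [hi, crossDen, Complex.neg_re, Complex.one_re, Complex.neg_im, Complex.one_im]
    norm_num
  · have : bentPos i j u.1 = 0 := by simp [bentPos, crossNum, hi]
    rw [this]
    norm_num

theorem abs_sub_lt_of_mem_bentRegion [Nontrivial (Fin n)] (hl0 : 0 < l) (hl2 : l < (n : ℝ) - 2)
    {u : ThreadSpace n l} {i j k m : Fin n} (hk : k ≠ i) (hm : m ≠ i)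
    (hu : u ∈ bentRegion l i j (Ioo (-1) 1)) (hi : u.1 i ≠ -1) :
    |threadSlope u.1 k - threadSlope u.1 m| < |threadSlope u.1 i - threadSlope u.1 m| := by
  obtain ⟨hne, hD, hpos⟩ := hu
  have hσ := spread_pos (j := j) (threadSlope_notMem_constAwayFrom hl0 hl2 u hne)
  have h0 := one_add_re_ne_zero (u.2.1 i) hi
  have hN : crossNum (threadSlope u.1 j) (u.1 i) =
      (threadSlope u.1 i - threadSlope u.1 j) * (1 + (u.1 i).re) := by
    have : (u.1 i).im = threadSlope u.1 i * (1 + (u.1 i).re) := by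
      rw [threadSlope, halfSlope, div_mul_cancel₀ _ h0]
    rw [crossNum, this]
    ring
  have hmul := crossDen_mul (u.2.1 i) (threadSlope u.1 j)
  have hDeq : crossDen (threadSlope u.1 j) (u.1 i) =
      (threadSlope u.1 i - threadSlope u.1 j) ^ 2 * (1 + (u.1 i).re) := by
    refine mul_right_cancel₀ h0 ?_
    rw [hmul, hN]
    ring
  have hd : threadSlope u.1 i - threadSlope u.1 j ≠ 0 := fun h => by
    rw [hDeq, h] at hD
    simp at hD
  have hval : bentPos i j u.1 =
      3 * spread i j (threadSlope u.1) / (threadSlope u.1 i - threadSlope u.1 j) := by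
    rw [bentPos, hN, hDeq]
    field_simp
  have h1 : 3 * spread i j (threadSlope u.1) < |threadSlope u.1 i - threadSlope u.1 j| := by
    have := abs_lt.2 hpos
    rwa [hval, abs_div, div_lt_one (abs_pos.2 hd), abs_of_pos (by positivity)] at this
  have h2 := abs_sub_le_spread j hk (threadSlope u.1)
  have h3 := abs_sub_le_spread j hm (threadSlope u.1)
  have h4 := abs_sub_le (threadSlope u.1 i) (threadSlope u.1 m) (threadSlope u.1 j)
  have h5 := abs_sub_le (threadSlope u.1 k) (threadSlope u.1 j) (threadSlope u.1 m)
  rw [abs_sub_comm (threadSlope u.1 j) (threadSlope u.1 m)] at h5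
  linarith

theorem disjoint_bentRegion (hn : 3 ≤ n) (hl0 : 0 < l) (hl2 : l < (n : ℝ) - 2) {i k : Fin n}
    (i' k' : Fin n) (hik : i ≠ k) :
    Disjoint (bentRegion l i i' (Ioo (-1) 1)) (bentRegion l k k' (Ioo (-1) 1)) := by
  have : Nontrivial (Fin n) := Fin.nontrivial_iff_two_le.2 (by omega)
  refine disjoint_left.2 fun u h1 h2 => ?_
  obtain ⟨m, hm⟩ : ∃ m, m ∉ ({i, k} : Finset (Fin n)) := by
    by_contra! h
    have h3 := Finset.card_le_card (fun m _ => h m : Finset.univ ⊆ ({i, k} : Finset (Fin n)))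
    rw [Finset.card_univ, Fintype.card_fin] at h3
    have := Finset.card_le_two (a := i) (b := k)
    omega
  simp only [Finset.mem_insert, Finset.mem_singleton, not_or] at hm
  exact lt_asymm (abs_sub_lt_of_mem_bentRegion hl0 hl2 hik.symm hm.1 h1 (h2.1 i hik))
    (abs_sub_lt_of_mem_bentRegion hl0 hl2 hik hm.2 h2 (h1.1 k hik.symm))

theorem bentRegion_inter_forwardRegion [Nontrivial (Fin n)] (hl0 : 0 < l)
    (hl2 : l < (n : ℝ) - 2) (i j : Fin n) :
    bentRegion l i j (Ioo (-1) 1) ∩ forwardRegion n l =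
      bentRegion l i j (Ioo 0 1) ∪ bentRegion l i j (Ioo (-1) 0) := by
  ext u
  constructor
  · rintro ⟨⟨hne, hD, hpos⟩, hu⟩
    have h0 : bentPos i j u.1 ≠ 0 := fun h => hu i ((bentPos_eq_zero_iff hl0 hl2 hne hD).1 h)
    rcases h0.lt_or_gt with h | h
    · exact Or.inr ⟨hne, hD, hpos.1, h⟩
    · exact Or.inl ⟨hne, hD, h, hpos.2⟩
  · intro hu
    obtain ⟨hne, hD, hpos, h0⟩ : (∀ k, k ≠ i → u.1 k ≠ -1) ∧
        0 < crossDen (threadSlope u.1 j) (u.1 i) ∧ bentPos i j u.1 ∈ Ioo (-1 : ℝ) 1 ∧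
        bentPos i j u.1 ≠ 0 := by
      rcases hu with ⟨h1, h2, h3, h4⟩ | ⟨h1, h2, h3, h4⟩
      · exact ⟨h1, h2, ⟨by linarith, h4⟩, h3.ne'⟩
      · exact ⟨h1, h2, ⟨h3, by linarith⟩, h4.ne⟩
    refine ⟨⟨hne, hD, hpos⟩, fun k => ?_⟩
    by_cases hk : k = i
    · rw [hk]
      exact fun h => h0 ((bentPos_eq_zero_iff hl0 hl2 hne hD).2 h)
    · exact hne k hk

end ThreadCover

/-- Let `n ≥ 6` and `n - 4 < l < n - 2` with `l` not a natural number.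
The configuration space of the discrete thread of `n` unit segments with its two endpoints
fixed at distance `l` is `M = {u ∈ (S¹)^n : Σ u_i = l}`, and its fundamental group at every
basepoint is isomorphic to the free group on `n` generators. -/
theorem fundamentalGroup_thread_fixed_endpoints_free (n : ℕ) (hn : 6 ≤ n)
    (l : ℝ) (hl1 : (n : ℝ) - 4 < l) (hl2 : l < (n : ℝ) - 2) (hlnat : ∀ k : ℕ, l ≠ k)
    (x : {u : Fin n → ℂ // (∀ i, ‖u i‖ = 1) ∧ ∑ i, u i = (l : ℂ)}) :
    Nonempty
      (FundamentalGroup {u : Fin n → ℂ // (∀ i, ‖u i‖ = 1) ∧ ∑ i, u i = (l : ℂ)} x ≃*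
        FreeGroup (Fin n)) := by
  have hn' : (6 : ℝ) ≤ n := by exact_mod_cast hn
  have hl0 : 0 < l := by linarith
  have : Nontrivial (Fin n) := Fin.nontrivial_iff_two_le.2 (by omega)
  have : Nonempty (ThreadSpace n l) := ⟨x⟩
  choose j hj using fun i : Fin n => exists_ne i
  have hsc {a b : ℝ} (hab : a < b) (ha : -1 ≤ a) (hb : b ≤ 1) (i : Fin n) :
      IsSimplyConnected (bentRegion l i (j i) (Set.Ioo a b)) :=
    isSimplyConnected_bentRegion hn hl1 hl2 (hj i) isOpen_Ioo (convex_Ioo a b)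
      (Set.nonempty_Ioo.2 hab) (Set.Ioo_subset_Ioo ha hb)
  refine nonempty_fundamentalGroup_mulEquiv_freeGroup (U := forwardRegion n l)
    (V := fun i => bentRegion l i (j i) (Set.Ioo (-1) 1))
    (P := fun i => bentRegion l i (j i) (Set.Ioo 0 1))
    (N := fun i => bentRegion l i (j i) (Set.Ioo (-1) 0)) isOpen_forwardRegion
    (fun i => isOpen_bentRegion (hj i) isOpen_Ioo) (fun i => isOpen_bentRegion (hj i) isOpen_Ioo)
    (fun i => isOpen_bentRegion (hj i) isOpen_Ioo) (fun u => ?_)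
    (fun i k hik => disjoint_bentRegion (by omega) hl0 hl2 (j i) (j k) hik)
    (fun i => bentRegion_inter_forwardRegion hl0 hl2 i (j i))
    (fun i => Set.disjoint_left.2 fun u h1 h2 => lt_asymm h1.2.2.1 h2.2.2.2)
    (isSimplyConnected_forwardRegion hn hl1 hl2) (hsc (by norm_num) le_rfl le_rfl)
    (fun i => (hsc one_pos (by norm_num) le_rfl i).isPathConnected)
    (fun i => (hsc (by norm_num) le_rfl zero_le_one i).isPathConnected) x
  by_cases h : ∃ i, u.1 i = -1
  · obtain ⟨i, hi⟩ := h
    exact Or.inr ⟨i, mem_bentRegion_of_eq_neg_one hl1 (j i) hi⟩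
  · push Not at h
    exact Or.inl h
end

section
/- Let n ≥ 1 and let l_1, …, l_n be positive real numbers satisfying Σ_{i=1}^{n} ν_i l_i ≠ 0 for every choice of signs ν_i = ±1. Define f : ℝ^n → ℝ² by f(θ_1, …, θ_n) = (Σ_{i=1}^{n} l_i cos θ_i, Σ_{i=1}^{n} l_i sin θ_i). Then at every point θ ∈ ℝ^n with f(θ) = 0, the derivative Df(θ) : ℝ^n → ℝ² is surjective; that is, 0 is a regular value of f. -/
/-- The derivative of the map sending the side angles of a planar linkage to the vector joining
its endpoints. -/
theorem hasFDerivAt_linkage {ι : Type*} [Fintype ι] (l θ : ι → ℝ) :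
    HasFDerivAt (fun θ : ι → ℝ ↦ (∑ i, l i * Real.cos (θ i), ∑ i, l i * Real.sin (θ i)))
      ((∑ i, l i • -Real.sin (θ i) • ContinuousLinearMap.proj (R := ℝ) (φ := fun _ : ι ↦ ℝ) i).prod
        (∑ i, l i • Real.cos (θ i) • ContinuousLinearMap.proj (R := ℝ) (φ := fun _ : ι ↦ ℝ) i))
      θ :=
  (HasFDerivAt.fun_sum fun i _ ↦ ((hasFDerivAt_apply i θ).cos.const_mul (l i))).prodMk
    (HasFDerivAt.fun_sum fun i _ ↦ ((hasFDerivAt_apply i θ).sin.const_mul (l i)))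

/-- If two sides of a planar linkage are not parallel, its endpoint map is a submersion. -/
theorem surjective_fderiv_linkage {ι : Type*} [Fintype ι] (l θ : ι → ℝ) {i j : ι}
    (hi : l i ≠ 0) (hj : l j ≠ 0) (h : Real.sin (θ i - θ j) ≠ 0) :
    Function.Surjective (fderiv ℝ
      (fun θ : ι → ℝ ↦ (∑ i, l i * Real.cos (θ i), ∑ i, l i * Real.sin (θ i))) θ) := by
  classical
  rintro ⟨a, b⟩
  rw [(hasFDerivAt_linkage l θ).fderiv]
  rw [Real.sin_sub] at h
  set D := Real.sin (θ i) * Real.cos (θ j) - Real.cos (θ i) * Real.sin (θ j) with hD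
  refine ⟨Pi.single i (-(a * Real.cos (θ j) + b * Real.sin (θ j)) / (l i * D)) +
    Pi.single j ((a * Real.cos (θ i) + b * Real.sin (θ i)) / (l j * D)), ?_⟩
  simp only [ContinuousLinearMap.prod_apply, sum_apply,
    smul_apply, ContinuousLinearMap.proj_apply, Pi.add_apply, smul_eq_mul,
    mul_add, Finset.sum_add_distrib, Pi.single_apply, mul_ite, mul_zero, Finset.sum_ite_eq',
    Finset.mem_univ, if_true, Prod.mk.injEq]
  constructor <;> field_simp <;> rw [hD] <;> ring

/-- A closed linkage all of whose sides are parallel has a vanishing signed sum of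
lengths. -/
theorem exists_signed_sum_eq_zero {ι : Type*} [Fintype ι] (l θ : ι → ℝ) (φ : ℝ)
    (hcos : ∑ i, l i * Real.cos (θ i) = 0) (hsin : ∑ i, l i * Real.sin (θ i) = 0)
    (h : ∀ i, Real.sin (θ i - φ) = 0) :
    ∃ ν : ι → ℝ, (∀ i, ν i = 1 ∨ ν i = -1) ∧ ∑ i, ν i * l i = 0 := by
  refine ⟨fun i ↦ Real.cos (θ i - φ), fun i ↦ (Real.sin_eq_zero_iff_cos_eq.1 (h i)), ?_⟩
  calc ∑ i, Real.cos (θ i - φ) * l i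
      = Real.cos φ * ∑ i, l i * Real.cos (θ i) + Real.sin φ * ∑ i, l i * Real.sin (θ i) := by
        rw [Finset.mul_sum, Finset.mul_sum, ← Finset.sum_add_distrib]
        refine Finset.sum_congr rfl fun i _ ↦ ?_
        rw [Real.cos_sub]
        ring
    _ = 0 := by rw [hcos, hsin, mul_zero, mul_zero, add_zero]

/-- Let `l_1, …, l_n` be positive lengths satisfying the genericity
condition `Σ ν_i l_i ≠ 0` for every choice of signs `ν_i = ±1`, and let
`f(θ) = (Σ l_i cos θ_i, Σ l_i sin θ_i)`.  Then at every point `θ` with `f θ = 0`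
the derivative `Df(θ) : ℝ^n → ℝ²` is surjective, i.e. `0` is a regular value of `f`. -/
theorem regular_value_of_closing_map (n : ℕ) (hn : 1 ≤ n) (l : Fin n → ℝ)
    (hl : ∀ i, 0 < l i)
    (hgen : ∀ ν : Fin n → ℝ, (∀ i, ν i = 1 ∨ ν i = -1) → ∑ i, ν i * l i ≠ 0)
    (f : (Fin n → ℝ) → ℝ × ℝ)
    (hf : ∀ θ, f θ = (∑ i, l i * Real.cos (θ i), ∑ i, l i * Real.sin (θ i))) :
    ∀ θ : Fin n → ℝ, f θ = 0 → Function.Surjective (fderiv ℝ f θ) := by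
  intro θ hθ
  obtain rfl : f = fun θ ↦ (∑ i, l i * Real.cos (θ i), ∑ i, l i * Real.sin (θ i)) := funext hf
  obtain ⟨hcos, hsin⟩ := Prod.mk.inj hθ
  have hij : ∃ i, Real.sin (θ i - θ ⟨0, hn⟩) ≠ 0 := by
    by_contra! h
    obtain ⟨ν, hν, hsum⟩ := exists_signed_sum_eq_zero l θ _ hcos hsin h
    exact hgen ν hν hsum
  obtain ⟨i, hi⟩ := hij
  exact surjective_fderiv_linkage l θ (hl i).ne' (hl _).ne' hi
end
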